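/- arXiv:2406.07273 — 2 statements merged into one kernel-verified Lean document; each statement's English description precedes it below -/
import Mathlib

section
/- For every ε > 0 there exist a real Banach space X and a continuous linear bijection T : X → c₀ satisfying ‖x‖ ≤ ‖T x‖_∞ ≤ (1+ε)·‖x‖ for all x ∈ X, such that whenever f, g ∈ NA(X,ℝ) are linearly independent and 0 < t < 1, the functional t·f + (1−t)·g is not norm-attaining. -/
open Filter Topology

/-- The Banach space of real null sequences. -/
local notation "c₀" => ZeroAtInftyContinuousMap ℕ ℝ

/-- A type synonym of `E`, to be normed by the seminorm `p`. -/
def Renormed {E : Type} [AddCommGroup E] [Module ℝ E] (_ : Seminorm ℝ E) : Type := E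

/-- A Banach space, equipped with an equivalent norm `p`, is a Banach space. -/
theorem exists_renorming {E : Type} [NormedAddCommGroup E] [NormedSpace ℝ E] [CompleteSpace E]
    (p : Seminorm ℝ E) (ε : ℝ) (hp : ∀ x, p x ≤ ‖x‖ ∧ ‖x‖ ≤ (1 + ε) * p x) :
    ∃ (X : Type) (_ : NormedAddCommGroup X) (_ : NormedSpace ℝ X) (_ : CompleteSpace X)
      (T : X →L[ℝ] E), Function.Bijective T ∧ ∀ x, ‖x‖ = p (T x) := by
  let A : AddCommGroup (Renormed p) := inferInstanceAs (AddCommGroup E)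
  let M : Module ℝ (Renormed p) := inferInstanceAs (Module ℝ E)
  let N : Norm (Renormed p) := ⟨p⟩
  have core : NormedSpace.Core ℝ (Renormed p) :=
    { norm_nonneg := fun x => apply_nonneg p x
      norm_smul := fun c x => map_smul_eq_mul p c x
      norm_triangle := fun x y => map_add_le_add p x y
      norm_eq_zero_iff := fun x => by
        constructor
        · intro h
          have h1 := (hp x).2
          have h2 : p x = 0 := h
          rw [h2, mul_zero] at h1
          exact norm_le_zero_iff.1 h1
        · rintro rfl
          exact map_zero p }
  let G : NormedAddCommGroup (Renormed p) := NormedAddCommGroup.ofCore core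
  let S : NormedSpace ℝ (Renormed p) := NormedSpace.ofCore core
  let L : Renormed p →ₗ[ℝ] E := (LinearMap.id : E →ₗ[ℝ] E)
  let T : Renormed p →L[ℝ] E := L.mkContinuous (1 + ε) (fun x => (hp x).2)
  let e : Renormed p ≃ E := Equiv.refl E
  have he : IsUniformEmbedding e := by
    refine AntilipschitzWith.isUniformEmbedding (K := 1) ?_ T.uniformContinuous
    refine AntilipschitzWith.of_le_mul_dist fun x y => ?_
    rw [NNReal.coe_one, one_mul, dist_eq_norm, dist_eq_norm]
    exact (hp (L x - L y)).1
  exact ⟨Renormed p, G, S, (completeSpace_congr he).2 inferInstance, T, Function.bijective_id,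
    fun _ => rfl⟩

/-- The gauge of the unit sublevel set of an even convex function `F`, if this set lies between the
balls of radii `1` and `1 + ε`. -/
theorem exists_seminorm {E : Type*} [NormedAddCommGroup E] [NormedSpace ℝ E] {F : E → ℝ} {ε : ℝ}
    (hε : 0 < ε) (hF : ConvexOn ℝ Set.univ F) (hneg : ∀ x, F (-x) = F x)
    (hle : ∀ x, ‖x‖ ≤ 1 → F x ≤ 1) (hge : ∀ x, F x ≤ 1 → ‖x‖ ≤ 1 + ε) :
    ∃ p : Seminorm ℝ E, (∀ x, p x ≤ ‖x‖ ∧ ‖x‖ ≤ (1 + ε) * p x) ∧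
      (∀ x, F x ≤ 1 → p x ≤ 1) ∧ ∀ x, p x < 1 → F x ≤ 1 := by
  obtain ⟨S, hS⟩ : ∃ S : Set E, ∀ x, x ∈ S ↔ F x ≤ 1 :=
    ⟨{x | F x ≤ 1}, fun _ => Iff.rfl⟩
  have hconv : Convex ℝ S := by
    have h := hF.convex_le 1
    rwa [show {x | x ∈ Set.univ ∧ F x ≤ 1} = S by ext x; simp [hS]] at h
  have hball : Metric.closedBall (0 : E) 1 ⊆ S := fun x hx =>
    (hS x).2 (hle x (by simpa using hx))
  have h0 : (0 : E) ∈ S := hball (by simp)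
  have hbal : Balanced ℝ S := by
    rintro r hr _ ⟨x, hx, rfl⟩
    have hr' : |r| ≤ 1 := hr
    have key : ∀ x ∈ S, ∀ r : ℝ, 0 ≤ r → r ≤ 1 → r • x ∈ S := fun x hx r h1 h2 =>
      hconv.smul_mem_of_zero_mem h0 hx ⟨h1, h2⟩
    rcases le_total 0 r with h | h
    · exact key x hx r h (by rwa [abs_of_nonneg h] at hr')
    · have hnx : -x ∈ S := by
        rwa [hS, hneg, ← hS]
      have := key (-x) hnx (-r) (by linarith) (by rwa [abs_of_nonpos h] at hr')
      rwa [smul_neg, neg_smul, neg_neg] at this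
  have habs : Absorbent ℝ S :=
    absorbent_nhds_zero (Filter.mem_of_superset (Metric.closedBall_mem_nhds 0 one_pos) hball)
  have hlt : ∀ x, gauge S x < 1 → x ∈ S := fun x hx =>
    setOfPred_gauge_lt_one_subset_self hconv h0 habs hx
  refine ⟨gaugeSeminorm hbal hconv habs, fun x => ⟨?_, ?_⟩, fun x hx =>
    gauge_le_one_of_mem ((hS x).2 hx), fun x hx => (hS x).1 (hlt x hx)⟩
  · change gauge S x ≤ ‖x‖
    have := gauge_mono (absorbent_nhds_zero (Metric.closedBall_mem_nhds (0 : E) one_pos)) hball x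
    rwa [gauge_closedBall zero_le_one, div_one] at this
  · change ‖x‖ ≤ (1 + ε) * gauge S x
    refine le_of_forall_pos_le_add fun δ hδ => ?_
    set r := gauge S x + δ / (1 + ε) with hr
    have hg : 0 ≤ gauge S x := gauge_nonneg x
    have hr0 : 0 < r := by positivity
    have h1 : gauge S (r⁻¹ • x) < 1 := by
      rw [gauge_smul_of_nonneg (by positivity), smul_eq_mul, inv_mul_lt_iff₀ hr0, mul_one, hr]
      have : 0 < δ / (1 + ε) := by positivity
      linarith
    have h2 := hge _ ((hS _).1 (hlt _ h1))
    rw [norm_smul, norm_inv, Real.norm_of_nonneg hr0.le, inv_mul_le_iff₀ hr0] at h2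
    have h3 : r * (1 + ε) = (1 + ε) * gauge S x + δ := by
      rw [hr]
      field_simp
    linarith

/-- Let `F` be a convex function whose unit sublevel set is the unit ball of a seminorm `p`, and let
`D x` be a linear majorant of the directional derivatives of `F` at `x`. A functional which attains
its `p`-norm at `x` is proportional to `D x`. -/
theorem eq_smul_of_attains {E : Type*} [AddCommGroup E] [Module ℝ E] (p : Seminorm ℝ E)
    (F : E → ℝ) (D : E → E →ₗ[ℝ] ℝ) (h1 : ∀ y, F y ≤ 1 → p y ≤ 1) (h2 : ∀ y, p y < 1 → F y ≤ 1)
    (hconv : ∀ x y, 2 * F x ≤ F (x + y) + F (x - y))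
    (hD : ∀ x y, ∃ C s₀ : ℝ, 0 < s₀ ∧ ∀ s, |s| ≤ s₀ → F (x + s • y) ≤ F x + s * D x y + C * s ^ 2)
    (hFD : ∀ x, F x ≤ D x x) (x : E) (hx : p x = 1) (f : E →ₗ[ℝ] ℝ)
    (hf : ∀ y, |f y| ≤ |f x| * p y) :
    0 < D x x ∧ ∀ y, f y = f x / D x x * D x y := by
  have small : ∀ A C s₀ : ℝ, 0 < A → 0 < s₀ → ∃ s, 0 < s ∧ s ≤ s₀ ∧ s ≤ 1 / 2 ∧ s * C ≤ A := by
    intro A C s₀ hA hs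
    have hC : 0 < |C| + 1 := by positivity
    refine ⟨min (min s₀ (1 / 2)) (A / (|C| + 1)), by positivity,
      (min_le_left _ _).trans (min_le_left _ _), (min_le_left _ _).trans (min_le_right _ _), ?_⟩
    set s := min (min s₀ (1 / 2)) (A / (|C| + 1)) with hsdef
    have hs0 : 0 < s := by positivity
    have h3 : s * (|C| + 1) ≤ A := (le_div_iff₀ hC).1 (min_le_right _ _)
    nlinarith [le_abs_self C]
  have hpx : ∀ s : ℝ, p (x + s • x) = |1 + s| := by
    intro s
    rw [show x + s • x = (1 + s) • x by rw [add_smul, one_smul], map_smul_eq_mul, hx, mul_one,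
      Real.norm_eq_abs]
  obtain ⟨C, s₀, hs₀, hC⟩ := hD x x
  have hF1 : F x ≤ 1 := by
    by_contra! hlt
    obtain ⟨s, hs, hss₀, hs2, hsA⟩ := small ((F x - 1) / 2) (D x x + |C|) s₀ (by linarith) hs₀
    have e1 := hC s (by rwa [abs_of_pos hs])
    have e2 : F (x - s • x) ≤ 1 := by
      apply h2
      have := hpx (-s)
      rw [neg_smul, ← sub_eq_add_neg] at this
      rw [this, abs_of_pos (by linarith)]
      linarith
    have e3 := hconv x (s • x)
    nlinarith [le_abs_self C, abs_nonneg C, mul_nonneg (abs_nonneg C) hs.le]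
  have hF2 : 1 ≤ F x := by
    by_contra! hlt
    obtain ⟨s, hs, hss₀, hs2, hsA⟩ := small (1 - F x) (D x x + |C|) s₀ (by linarith) hs₀
    have e1 := hC s (by rwa [abs_of_pos hs])
    have e2 : F (x + s • x) ≤ 1 := by
      nlinarith [le_abs_self C, abs_nonneg C, mul_nonneg (abs_nonneg C) hs.le]
    have e3 := h1 _ e2
    rw [hpx, abs_of_pos (by linarith)] at e3
    linarith
  have hDx : 0 < D x x := by linarith [hFD x]
  have key : ∀ y, D x y < 0 → f x * f y ≤ 0 := by
    intro y hy
    obtain ⟨C, s₀, hs₀, hC⟩ := hD x y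
    obtain ⟨s, hs, hss₀, hs2, hsA⟩ := small (-D x y) C s₀ (by linarith) hs₀
    have e1 := hC s (by rwa [abs_of_pos hs])
    have e2 : F (x + s • y) ≤ 1 := by nlinarith
    have e3 := h1 _ e2
    have e4 : |f (x + s • y)| ≤ |f x| :=
      (hf _).trans (mul_le_of_le_one_right (abs_nonneg _) e3)
    rw [map_add, map_smul, smul_eq_mul] at e4
    have e5 : f x * (f x + s * f y) ≤ f x * f x :=
      calc f x * (f x + s * f y) ≤ |f x| * |f x + s * f y| := by
            rw [← abs_mul]; exact le_abs_self _
        _ ≤ |f x| * |f x| := by gcongr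
        _ = f x * f x := abs_mul_abs_self _
    by_contra! h
    nlinarith [mul_pos hs h]
  have key0 : ∀ y, D x y = 0 → f x * f y ≤ 0 := by
    intro y hy
    by_contra! h
    have hδ : 0 < f x * f y / (f x * f x + 1) := by
      have := mul_self_nonneg (f x)
      positivity
    have := key (y - (f x * f y / (f x * f x + 1)) • x)
      (by rw [map_sub, map_smul, hy, smul_eq_mul]; nlinarith [mul_pos hδ hDx])
    rw [map_sub, map_smul, smul_eq_mul] at this
    have e : f x * f y / (f x * f x + 1) * (f x * f x + 1) = f x * f y :=
      div_mul_cancel₀ _ (by nlinarith [mul_self_nonneg (f x)])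
    nlinarith
  have key1 : ∀ y, D x y = 0 → f y = 0 := by
    intro y hy
    have e1 := key0 y hy
    have e2 := key0 (-y) (by rw [map_neg, hy, neg_zero])
    rw [map_neg] at e2
    have e3 : f x * f y = 0 := by linarith
    rcases mul_eq_zero.1 e3 with h | h
    · have := hf y
      rw [h, abs_zero, zero_mul] at this
      exact abs_eq_zero.1 (le_antisymm this (abs_nonneg _))
    · exact h
  refine ⟨hDx, fun y => ?_⟩
  have := key1 (y - (D x y / D x x) • x) (by
    rw [map_sub, map_smul, smul_eq_mul, div_mul_cancel₀ _ hDx.ne', sub_self])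
  rw [map_sub, map_smul, smul_eq_mul, sub_eq_zero] at this
  rw [this]
  ring

/-- If three points of the plane satisfy a linear relation between their cubes in the symmetric
tensor algebra, then the first two are proportional. -/
theorem det_eq_zero_of_cubic_relation {a₁ b₁ a₂ b₂ a₃ b₃ l₁ l₂ l₃ : ℝ} (hl₁ : l₁ ≠ 0)
    (hl₂ : l₂ ≠ 0) (haaa : l₁ * a₁ ^ 3 + l₂ * a₂ ^ 3 + l₃ * a₃ ^ 3 = 0)
    (haab : l₁ * (a₁ ^ 2 * b₁) + l₂ * (a₂ ^ 2 * b₂) + l₃ * (a₃ ^ 2 * b₃) = 0)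
    (habb : l₁ * (a₁ * b₁ ^ 2) + l₂ * (a₂ * b₂ ^ 2) + l₃ * (a₃ * b₃ ^ 2) = 0)
    (hbbb : l₁ * b₁ ^ 3 + l₂ * b₂ ^ 3 + l₃ * b₃ ^ 3 = 0) : a₁ * b₂ = b₁ * a₂ := by
  by_contra hne
  have hD : a₁ * b₂ - b₁ * a₂ ≠ 0 := sub_ne_zero.2 hne
  -- the relation applied to products of three linear forms `u • a + v • b`
  have form : ∀ u v u' v' u'' v'' : ℝ,
      l₁ * ((u * a₁ + v * b₁) * (u' * a₁ + v' * b₁) * (u'' * a₁ + v'' * b₁)) +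
      l₂ * ((u * a₂ + v * b₂) * (u' * a₂ + v' * b₂) * (u'' * a₂ + v'' * b₂)) +
      l₃ * ((u * a₃ + v * b₃) * (u' * a₃ + v' * b₃) * (u'' * a₃ + v'' * b₃)) = 0 := by
    intro u v u' v' u'' v''
    linear_combination u * u' * u'' * haaa + (u * u' * v'' + u * v' * u'' + v * u' * u'') * haab +
      (u * v' * v'' + v * u' * v'' + v * v' * u'') * habb + v * v' * v'' * hbbb
  have e1 : a₃ * b₁ - b₃ * a₁ = 0 := by
    have h : l₁ * (a₁ * b₂ - b₁ * a₂) * (a₃ * b₁ - b₃ * a₁) ^ 2 = 0 := by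
      linear_combination form (-b₃) a₃ (-b₃) a₃ b₂ (-a₂)
    simpa [hl₁, hD] using h
  have e2 : a₃ * b₂ - b₃ * a₂ = 0 := by
    have h : l₂ * (a₁ * b₂ - b₁ * a₂) * (a₃ * b₂ - b₃ * a₂) ^ 2 = 0 := by
      linear_combination - form (-b₃) a₃ (-b₃) a₃ b₁ (-a₁)
    simpa [hl₂, hD] using h
  have h : l₁ * (a₁ * b₂ - b₁ * a₂) ^ 3 = 0 := by
    have := form b₂ (-a₂) b₂ (-a₂) b₂ (-a₂)
    linear_combination this - l₃ * (a₃ * b₂ - b₃ * a₂) ^ 2 * e2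
  simp [hl₁, hD] at h

theorem abs_coord_le_norm (x : c₀) (n : ℕ) : |x n| ≤ ‖x‖ := by
  rw [← ZeroAtInftyContinuousMap.norm_toBCF_eq_norm]
  exact x.toBCF.norm_coe_le_norm n

theorem tendsto_coord (x : c₀) : Tendsto x atTop (𝓝 0) := by
  have := x.zero_at_infty'
  rwa [cocompact_eq_cofinite, Nat.cofinite_eq_atTop] at this

theorem exists_forall_abs_coord_le (x : c₀) {δ : ℝ} (hδ : 0 < δ) : ∃ N, ∀ n, N ≤ n → |x n| ≤ δ := by
  obtain ⟨N, hN⟩ := Metric.tendsto_atTop.1 (tendsto_coord x) δ hδ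
  exact ⟨N, fun n hn => by simpa using (hN n hn).le⟩

/-- The `k`-th unit vector of `c₀`. -/
noncomputable def unitVec (k : ℕ) : c₀ where
  toFun := Pi.single k 1
  continuous_toFun := continuous_of_discreteTopology
  zero_at_infty' := by
    rw [cocompact_eq_cofinite, Nat.cofinite_eq_atTop]
    refine tendsto_const_nhds.congr' ?_
    filter_upwards [eventually_gt_atTop k] with n hn
    simp [hn.ne']

theorem unitVec_apply (k n : ℕ) : unitVec k n = if n = k then 1 else 0 := by
  change (Pi.single k 1 : ℕ → ℝ) n = _
  rw [Pi.single_apply]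

/-- The signed distance of a real number from the interval `[-1, 1]`. -/
noncomputable def excess (a : ℝ) : ℝ := a - max (-1) (min 1 a)

theorem abs_sub_excess_le (a : ℝ) : |a - excess a| ≤ 1 := by
  rw [excess, sub_sub_cancel, abs_le]
  exact ⟨le_max_left _ _, max_le (by norm_num) (min_le_left _ _)⟩

theorem excess_sq_le (a : ℝ) {q : ℝ} (hq : |q| ≤ 1) : excess a ^ 2 ≤ (a - q) ^ 2 := by
  rw [abs_le] at hq
  unfold excess
  rcases le_total 1 a with h | h
  · rw [min_eq_left h, max_eq_right (by norm_num)]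
    nlinarith
  · rw [min_eq_right h]
    rcases le_total (-1) a with h' | h'
    · rw [max_eq_right h', sub_self]
      nlinarith [sq_nonneg (a - q)]
    · rw [max_eq_left h']
      nlinarith

theorem excess_eq_zero {a : ℝ} (ha : |a| ≤ 1) : excess a = 0 := by
  have := excess_sq_le a ha
  rw [sub_self] at this
  nlinarith [sq_nonneg (excess a)]

theorem excess_neg_sq (a : ℝ) : excess (-a) ^ 2 = excess a ^ 2 := by
  have key : ∀ a : ℝ, excess (-a) ^ 2 ≤ excess a ^ 2 := fun a => by
    have := excess_sq_le (-a) (q := -(a - excess a)) (by rw [abs_neg]; exact abs_sub_excess_le a)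
    linarith
  exact le_antisymm (key a) (by simpa using key (-a))

theorem excess_sq_add_le (a b : ℝ) :
    excess (a + b) ^ 2 ≤ excess a ^ 2 + 2 * excess a * b + b ^ 2 := by
  have := excess_sq_le (a + b) (abs_sub_excess_le a)
  linarith

theorem excess_sq_le_mul_self (a : ℝ) : excess a ^ 2 ≤ excess a * a := by
  unfold excess
  rcases le_total 1 a with h | h
  · rw [min_eq_left h, max_eq_right (by norm_num)]
    nlinarith
  · rw [min_eq_right h]
    rcases le_total (-1) a with h' | h'
    · rw [max_eq_right h', sub_self]
      simp
    · rw [max_eq_left h']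
      nlinarith

theorem convexOn_excess_sq : ConvexOn ℝ Set.univ fun a => excess a ^ 2 := by
  refine ⟨convex_univ, fun a _ b _ s t hs ht hst => ?_⟩
  have hq : |s * (a - excess a) + t * (b - excess b)| ≤ 1 := by
    have ha := abs_le.1 (abs_sub_excess_le a)
    have hb := abs_le.1 (abs_sub_excess_le b)
    rw [abs_le]
    constructor <;> nlinarith
  have := excess_sq_le (s • a + t • b) hq
  simp only [smul_eq_mul] at this ⊢
  refine this.trans ?_
  have e : t = 1 - s := by linarith
  subst e
  nlinarith [mul_nonneg (mul_nonneg hs ht) (sq_nonneg (excess a - excess b))]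

theorem abs_le_of_excess_sq_le {a ε : ℝ} (hε : 0 ≤ ε) (h : excess a ^ 2 ≤ ε ^ 2) : |a| ≤ 1 + ε := by
  have h1 := abs_le_of_sq_le_sq h hε
  have h2 := abs_sub_excess_le a
  calc |a| = |(a - excess a) + excess a| := by rw [sub_add_cancel]
    _ ≤ |a - excess a| + |excess a| := abs_add_le _ _
    _ ≤ 1 + ε := add_le_add h2 h1

/-- Indices `(j, k, σ, m)` of the functionals perturbing `x j + x k` and `x j - x k`. -/
abbrev Idx : Type := ℕ × ℕ × Bool × ℕ

/-- The summands of the functionals `spread i` are absolutely summable. -/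
theorem summable_spread (i : ℕ) (x : c₀) :
    Summable fun t : ℕ => (1 / 2 : ℝ) ^ t * x (Nat.pair i t) := by
  refine Summable.of_norm_bounded (summable_geometric_two.mul_right ‖x‖) fun t => ?_
  rw [norm_mul, Real.norm_of_nonneg (by positivity)]
  gcongr
  exact abs_coord_le_norm x _

/-- For different `i`, these functionals have disjoint infinite supports. -/
noncomputable def spread (i : ℕ) : c₀ →ₗ[ℝ] ℝ where
  toFun x := ∑' t : ℕ, (1 / 2 : ℝ) ^ t * x (Nat.pair i t)
  map_add' x y := by
    rw [← (summable_spread i x).tsum_add (summable_spread i y)]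
    simp only [ZeroAtInftyContinuousMap.add_apply, mul_add]
  map_smul' c x := by
    rw [RingHom.id_apply, smul_eq_mul, ← tsum_mul_left]
    simp only [ZeroAtInftyContinuousMap.smul_apply, smul_eq_mul, mul_left_comm]

theorem abs_spread_le (i : ℕ) (x : c₀) : |spread i x| ≤ 2 * ‖x‖ := by
  change ‖∑' t : ℕ, (1 / 2 : ℝ) ^ t * x (Nat.pair i t)‖ ≤ _
  refine tsum_of_norm_bounded (hasSum_geometric_two.mul_right ‖x‖) fun t => ?_
  rw [norm_mul, Real.norm_of_nonneg (by positivity)]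
  gcongr
  exact abs_coord_le_norm x _

theorem spread_unitVec (i i' t : ℕ) :
    spread i (unitVec (Nat.pair i' t)) = if i = i' then (1 / 2) ^ t else 0 := by
  change ∑' s : ℕ, (1 / 2 : ℝ) ^ s * unitVec (Nat.pair i' t) (Nat.pair i s) = _
  rw [tsum_eq_single t]
  · simp [unitVec_apply, Nat.pair_eq_pair]
  · intro s hs
    simp [unitVec_apply, Nat.pair_eq_pair, hs]

/-- The sign encoded by a boolean. -/
noncomputable def boolSign (σ : Bool) : ℝ := if σ then 1 else -1

theorem abs_boolSign (σ : Bool) : |boolSign σ| = 1 := by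
  cases σ <;> simp [boolSign]

/-- The functional `x ↦ x j ± x k`. -/
noncomputable def pairFun (i : Idx) : c₀ →ₗ[ℝ] ℝ where
  toFun x := x i.1 + boolSign i.2.2.1 * x i.2.1
  map_add' x y := by simp only [ZeroAtInftyContinuousMap.add_apply]; ring
  map_smul' c x := by
    simp only [ZeroAtInftyContinuousMap.smul_apply, RingHom.id_apply, smul_eq_mul]; ring

theorem pairFun_apply (i : Idx) (x : c₀) : pairFun i x = x i.1 + boolSign i.2.2.1 * x i.2.1 := rfl

theorem abs_pairFun_le (i : Idx) (x : c₀) : |pairFun i x| ≤ 2 * ‖x‖ := by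
  rw [pairFun_apply]
  refine (abs_add_le _ _).trans ?_
  rw [abs_mul, abs_boolSign]
  linarith [abs_coord_le_norm x i.1, abs_coord_le_norm x i.2.1]

/-- The functionals `x j ± x k`, perturbed so that they are independent modulo finitely supported
sequences. -/
noncomputable def pertFun (i : Idx) : c₀ →ₗ[ℝ] ℝ :=
  pairFun i + (1 / ((i.2.2.2 : ℝ) + 1)) • spread (Encodable.encode i)

theorem pertFun_apply (i : Idx) (x : c₀) :
    pertFun i x = pairFun i x + 1 / ((i.2.2.2 : ℝ) + 1) * spread (Encodable.encode i) x := rfl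

theorem abs_pertFun_le (i : Idx) (x : c₀) : |pertFun i x| ≤ 4 * ‖x‖ := by
  have h1 : 1 / ((i.2.2.2 : ℝ) + 1) ≤ 1 := by
    rw [div_le_one (by positivity)]
    linarith [(Nat.cast_nonneg i.2.2.2 : (0 : ℝ) ≤ _)]
  rw [pertFun_apply]
  refine (abs_add_le _ _).trans ?_
  rw [abs_mul, abs_of_nonneg (by positivity : 0 ≤ 1 / ((i.2.2.2 : ℝ) + 1))]
  have h2 := abs_spread_le (Encodable.encode i) x
  have h3 := mul_le_mul h1 h2 (abs_nonneg _) zero_le_one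
  linarith [abs_pairFun_le i x]

/-- The weights with which the functionals `pertFun i` enter the norm. -/
noncomputable def weight (i : Idx) : ℝ :=
  (1 / 512) * (1 / 2) ^ Encodable.encode i * (1 / 4) ^ (i.1 + i.2.1)

theorem weight_pos (i : Idx) : 0 < weight i := by unfold weight; positivity

theorem weight_le (i : Idx) : weight i ≤ (1 / 512) * (1 / 2) ^ Encodable.encode i :=
  mul_le_of_le_one_right (by positivity) (pow_le_one₀ (by norm_num) (by norm_num))

theorem tsum_geometric_two_encode_le {ι : Type*} [Encodable ι] :
    ∑' i : ι, (1 / 2 : ℝ) ^ Encodable.encode i ≤ 2 := by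
  have h : ∑' i : ι, (1 / 2 : ℝ) ^ Encodable.encode i ≤ ∑' n : ℕ, (1 / 2 : ℝ) ^ n :=
    summable_geometric_two_encode.tsum_le_tsum_of_inj (g := fun n : ℕ => (1 / 2 : ℝ) ^ n)
      Encodable.encode Encodable.encode_injective (fun _ _ => by positivity) (fun _ => le_rfl)
      summable_geometric_two
  rwa [tsum_geometric_two] at h

theorem summable_weight : Summable weight :=
  Summable.of_nonneg_of_le (fun i => (weight_pos i).le) weight_le
    (summable_geometric_two_encode.mul_left _)

theorem summable_weight_mul {b : Idx → ℝ} {C : ℝ} (hb : ∀ i, |b i| ≤ C) :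
    Summable fun i => weight i * b i := by
  refine Summable.of_norm_bounded (summable_weight.mul_right C) fun i => ?_
  rw [norm_mul, Real.norm_of_nonneg (weight_pos i).le]
  exact mul_le_mul_of_nonneg_left (hb i) (weight_pos i).le

/-- Limits of the perturbed functionals recover the sums and differences of coordinates. -/
theorem tendsto_pertFun (j k : ℕ) (σ : Bool) (x : c₀) :
    Tendsto (fun m : ℕ => pertFun (j, k, σ, m) x) atTop (𝓝 (x j + boolSign σ * x k)) := by
  have h : Tendsto (fun m : ℕ => 1 / ((m : ℝ) + 1) *
      spread (Encodable.encode ((j, k, σ, m) : Idx)) x) atTop (𝓝 0) := by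
    refine squeeze_zero_norm (a := fun m : ℕ => 1 / ((m : ℝ) + 1) * (2 * ‖x‖)) (fun m => ?_) ?_
    · rw [norm_mul, Real.norm_of_nonneg (by positivity)]
      gcongr
      exact abs_spread_le _ x
    · simpa using (tendsto_one_div_add_atTop_nhds_zero_nat (𝕜 := ℝ)).mul_const (2 * ‖x‖)
  simpa [pertFun_apply, pairFun_apply] using h.const_add (x j + boolSign σ * x k)

/-- A combination of the functionals `pertFun i` with coefficients dominated by the weights is not
finitely supported, unless it is trivial. -/
theorem eq_zero_of_tsum_pertFun_eq_zero {a : Idx → ℝ} {A : ℝ} (ha : ∀ i, |a i| ≤ A) {N : ℕ}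
    (h : ∀ k, N ≤ k → ∑' i, weight i * (a i * pertFun i (unitVec k)) = 0) (i₀ : Idx) :
    a i₀ = 0 := by
  have hA : 0 ≤ A := (abs_nonneg _).trans (ha i₀)
  have hbd : ∀ t, N ≤ t →
      |weight i₀ * (a i₀ * (1 / ((i₀.2.2.2 : ℝ) + 1)))| ≤ (2 * A) * (1 / 2) ^ t := by
    intro t ht
    set k := Nat.pair (Encodable.encode i₀) t with hk
    have htk : t ≤ k := Nat.right_le_pair _ _
    have h0 := h k (ht.trans htk)
    have hu : ‖unitVec k‖ ≤ 1 := by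
      rw [← ZeroAtInftyContinuousMap.norm_toBCF_eq_norm]
      refine (BoundedContinuousFunction.norm_le zero_le_one).2 fun n => ?_
      change |unitVec k n| ≤ 1
      rw [unitVec_apply]
      split_ifs <;> simp
    have hw : ∀ i : Idx, ‖weight i * (a i * pairFun i (unitVec k))‖ ≤
        (1 / 2) ^ Encodable.encode i * (A * (1 / 4) ^ k) := by
      intro i
      rw [norm_mul, norm_mul, Real.norm_of_nonneg (weight_pos i).le, Real.norm_eq_abs,
        Real.norm_eq_abs]
      have e1 : (1 / 4 : ℝ) ^ (i.1 + i.2.1) * |pairFun i (unitVec k)| ≤ 2 * (1 / 4) ^ k := by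
        by_cases hi : i.1 = k ∨ i.2.1 = k
        · have e2 : k ≤ i.1 + i.2.1 := by omega
          have e3 : (1 / 4 : ℝ) ^ (i.1 + i.2.1) ≤ (1 / 4) ^ k :=
            pow_le_pow_of_le_one (by norm_num) (by norm_num) e2
          have e4 : |pairFun i (unitVec k)| ≤ 2 := by linarith [abs_pairFun_le i (unitVec k)]
          have := mul_le_mul e3 e4 (abs_nonneg _) (by positivity)
          linarith
        · push Not at hi
          rw [pairFun_apply, unitVec_apply, unitVec_apply, if_neg hi.1, if_neg hi.2]
          simp
      have e5 : (1 / 4 : ℝ) ^ (i.1 + i.2.1) * |pairFun i (unitVec k)| * |a i| ≤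
          2 * (1 / 4) ^ k * A := mul_le_mul e1 (ha i) (abs_nonneg _) (by positivity)
      have e6 : (0 : ℝ) < (1 / 2) ^ Encodable.encode i := by positivity
      have e7 : 0 ≤ A * (1 / 4 : ℝ) ^ k := by positivity
      unfold weight
      nlinarith [mul_le_mul_of_nonneg_left e5 e6.le, mul_nonneg e6.le e7]
    have hsw : Summable fun i => weight i * (a i * pairFun i (unitVec k)) :=
      Summable.of_norm_bounded (summable_geometric_two_encode.mul_right _) hw
    have hws : |∑' i, weight i * (a i * pairFun i (unitVec k))| ≤ 2 * (A * (1 / 4) ^ k) := by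
      refine (tsum_of_norm_bounded
        (summable_geometric_two_encode.mul_right _).hasSum hw).trans ?_
      rw [tsum_mul_right]
      gcongr
      exact tsum_geometric_two_encode_le
    have hr : HasSum (fun i : Idx => weight i * (a i * (1 / ((i.2.2.2 : ℝ) + 1) *
        spread (Encodable.encode i) (unitVec k))))
        (weight i₀ * (a i₀ * (1 / ((i₀.2.2.2 : ℝ) + 1) * (1 / 2) ^ t))) := by
      have := hasSum_ite_eq i₀ (weight i₀ * (a i₀ * (1 / ((i₀.2.2.2 : ℝ) + 1) * (1 / 2) ^ t)))
      refine this.congr_fun ?_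
      intro i
      rw [hk, spread_unitVec]
      by_cases hi : i = i₀
      · subst hi; simp
      · simp [hi]
    have hsum := hsw.hasSum.add hr
    have e8 : ∑' i, weight i * (a i * pairFun i (unitVec k)) +
        weight i₀ * (a i₀ * (1 / ((i₀.2.2.2 : ℝ) + 1) * (1 / 2) ^ t)) = 0 := by
      rw [← hsum.tsum_eq, ← h0]
      refine tsum_congr fun i => ?_
      rw [pertFun_apply]
      ring
    have e9 : |weight i₀ * (a i₀ * (1 / ((i₀.2.2.2 : ℝ) + 1)))| * (1 / 2) ^ t ≤
        2 * (A * (1 / 4) ^ k) := by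
      rw [← abs_of_pos (by positivity : (0 : ℝ) < (1 / 2) ^ t), ← abs_mul]
      refine le_trans (le_of_eq ?_) hws
      rw [eq_neg_of_add_eq_zero_left e8, abs_neg]
      congr 1
      ring
    have e10 : (1 / 4 : ℝ) ^ k ≤ (1 / 2) ^ t * (1 / 2) ^ t := by
      rw [← mul_pow]
      norm_num only
      exact pow_le_pow_of_le_one (by norm_num) (by norm_num) htk
    have e11 : (0 : ℝ) < (1 / 2) ^ t := by positivity
    refine le_of_mul_le_mul_right ?_ e11
    calc _ ≤ 2 * (A * (1 / 4) ^ k) := e9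
      _ ≤ 2 * (A * ((1 / 2) ^ t * (1 / 2) ^ t)) := by gcongr
      _ = _ := by ring
  have hlim : Tendsto (fun t : ℕ => (2 * A) * (1 / 2 : ℝ) ^ t) atTop (𝓝 0) := by
    simpa using (tendsto_pow_atTop_nhds_zero_of_lt_one (r := (1 / 2 : ℝ)) (by norm_num)
      (by norm_num)).const_mul (2 * A)
  have hle := ge_of_tendsto hlim (eventually_atTop.2 ⟨N, hbd⟩)
  have h0 := abs_eq_zero.1 (le_antisymm hle (abs_nonneg _))
  have hm : (1 / ((i₀.2.2.2 : ℝ) + 1)) ≠ 0 := by positivity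
  simpa [(weight_pos i₀).ne', hm, Nat.cast_add_one_ne_zero] using h0

theorem hasFiniteSupport_excess_mul (x : c₀) (b : ℕ → ℝ) :
    (fun n => excess (x n) * b n).HasFiniteSupport := by
  obtain ⟨N, hN⟩ := exists_forall_abs_coord_le x one_pos
  refine (Set.finite_lt_nat N).subset fun n hn => ?_
  by_contra h
  exact hn (by simp [excess_eq_zero (hN n (not_lt.1 h))])

theorem summable_excess_mul (x : c₀) (b : ℕ → ℝ) : Summable fun n => excess (x n) * b n :=
  summable_of_hasFiniteSupport (hasFiniteSupport_excess_mul x b)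

theorem summable_excess_sq (x : c₀) : Summable fun n => excess (x n) ^ 2 := by
  simpa only [sq] using summable_excess_mul x fun n => excess (x n)

theorem summable_weight_mul_pertFun (x y : c₀) :
    Summable fun i => weight i * (4 * pertFun i x ^ 3 * pertFun i y) := by
  refine summable_weight_mul (C := 4 * (4 * ‖x‖) ^ 3 * (4 * ‖y‖)) fun i => ?_
  rw [abs_mul, abs_mul, abs_pow, abs_of_pos (by norm_num : (0 : ℝ) < 4)]
  gcongr
  exacts [abs_pertFun_le i x, abs_pertFun_le i y]

theorem summable_weight_mul_pow (x : c₀) : Summable fun i => weight i * pertFun i x ^ 4 := by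
  refine summable_weight_mul (C := (4 * ‖x‖) ^ 4) fun i => ?_
  rw [abs_pow]
  gcongr
  exact abs_pertFun_le i x

/-- The convex function whose unit sublevel set is the unit ball of the new norm. -/
noncomputable def energy (K : ℝ) (x : c₀) : ℝ :=
  K * ∑' n, excess (x n) ^ 2 + ∑' i, weight i * pertFun i x ^ 4

/-- The derivative of the first term of `energy`. -/
noncomputable def excessDeriv (x : c₀) : c₀ →ₗ[ℝ] ℝ where
  toFun y := 2 * ∑' n, excess (x n) * y n
  map_add' y z := by
    rw [← mul_add, ← (summable_excess_mul x y).tsum_add (summable_excess_mul x z)]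
    simp only [ZeroAtInftyContinuousMap.add_apply, mul_add]
  map_smul' c y := by
    rw [RingHom.id_apply, smul_eq_mul, mul_left_comm, ← tsum_mul_left (a := c)]
    simp only [ZeroAtInftyContinuousMap.smul_apply, smul_eq_mul, mul_left_comm c]

theorem excessDeriv_apply (x y : c₀) : excessDeriv x y = 2 * ∑' n, excess (x n) * y n := rfl

/-- The derivative of the second term of `energy`. -/
noncomputable def quarticDeriv (x : c₀) : c₀ →ₗ[ℝ] ℝ where
  toFun y := ∑' i, weight i * (4 * pertFun i x ^ 3 * pertFun i y)
  map_add' y z := by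
    rw [← (summable_weight_mul_pertFun x y).tsum_add (summable_weight_mul_pertFun x z)]
    simp only [map_add, mul_add]
  map_smul' c y := by
    rw [RingHom.id_apply, smul_eq_mul, ← tsum_mul_left]
    simp only [map_smul, smul_eq_mul, mul_left_comm]

theorem quarticDeriv_apply (x y : c₀) :
    quarticDeriv x y = ∑' i, weight i * (4 * pertFun i x ^ 3 * pertFun i y) := rfl

/-- The derivative of `energy`. -/
noncomputable def energyDeriv (K : ℝ) (x : c₀) : c₀ →ₗ[ℝ] ℝ := K • excessDeriv x + quarticDeriv x

theorem energyDeriv_apply (K : ℝ) (x y : c₀) :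
    energyDeriv K x y = K * excessDeriv x y + quarticDeriv x y := rfl

theorem energy_neg (K : ℝ) (x : c₀) : energy K (-x) = energy K x := by
  simp only [energy, ZeroAtInftyContinuousMap.neg_apply, excess_neg_sq, map_neg,
    (by decide : Even 4).neg_pow]

theorem convexOn_energy {K : ℝ} (hK : 0 ≤ K) : ConvexOn ℝ Set.univ (energy K) := by
  refine ⟨convex_univ, fun x _ y _ s t hs ht hst => ?_⟩
  have h1 : ∑' n, excess ((s • x + t • y) n) ^ 2 ≤
      s * ∑' n, excess (x n) ^ 2 + t * ∑' n, excess (y n) ^ 2 := by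
    rw [← tsum_mul_left, ← tsum_mul_left, ← ((summable_excess_sq x).mul_left s).tsum_add
      ((summable_excess_sq y).mul_left t)]
    refine (summable_excess_sq _).tsum_le_tsum (fun n => ?_)
      (((summable_excess_sq x).mul_left s).add ((summable_excess_sq y).mul_left t))
    exact convexOn_excess_sq.2 (Set.mem_univ _) (Set.mem_univ _) hs ht hst
  have h2 : ∑' i, weight i * pertFun i (s • x + t • y) ^ 4 ≤
      s * ∑' i, weight i * pertFun i x ^ 4 + t * ∑' i, weight i * pertFun i y ^ 4 := by
    rw [← tsum_mul_left, ← tsum_mul_left, ← ((summable_weight_mul_pow x).mul_left s).tsum_add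
      ((summable_weight_mul_pow y).mul_left t)]
    refine (summable_weight_mul_pow _).tsum_le_tsum (fun i => ?_)
      (((summable_weight_mul_pow x).mul_left s).add ((summable_weight_mul_pow y).mul_left t))
    have h3 : pertFun i (s • x + t • y) ^ 4 ≤ s * pertFun i x ^ 4 + t * pertFun i y ^ 4 := by
      rw [map_add, map_smul, map_smul]
      exact (Even.convexOn_pow (𝕜 := ℝ) (n := 4) (by decide)).2 (Set.mem_univ _) (Set.mem_univ _)
        hs ht hst
    have := mul_le_mul_of_nonneg_left h3 (weight_pos i).le
    linarith
  simp only [energy, smul_eq_mul]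
  nlinarith [mul_le_mul_of_nonneg_left h1 hK]

theorem two_mul_energy_le {K : ℝ} (hK : 0 ≤ K) (x y : c₀) :
    2 * energy K x ≤ energy K (x + y) + energy K (x - y) := by
  have h := (convexOn_energy hK).2 (Set.mem_univ (x + y)) (Set.mem_univ (x - y))
    (by norm_num : (0 : ℝ) ≤ 1 / 2) (by norm_num : (0 : ℝ) ≤ 1 / 2) (by norm_num)
  have e : (1 / 2 : ℝ) • (x + y) + (1 / 2 : ℝ) • (x - y) = x := by
    ext n
    simp only [ZeroAtInftyContinuousMap.add_apply, ZeroAtInftyContinuousMap.sub_apply,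
      ZeroAtInftyContinuousMap.smul_apply, smul_eq_mul]
    ring
  rw [congrArg (energy K) e, smul_eq_mul, smul_eq_mul] at h
  linarith

theorem energy_le_energyDeriv_self {K : ℝ} (hK : 0 ≤ K) (x : c₀) :
    energy K x ≤ energyDeriv K x x := by
  rw [energyDeriv_apply, excessDeriv_apply, quarticDeriv_apply]
  have h1 := (summable_excess_sq x).tsum_le_tsum (fun n => excess_sq_le_mul_self (x n))
    (summable_excess_mul x x)
  have h0 : 0 ≤ ∑' n, excess (x n) ^ 2 := tsum_nonneg fun n => sq_nonneg _
  have h2 : ∑' i, weight i * pertFun i x ^ 4 ≤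
      ∑' i, weight i * (4 * pertFun i x ^ 3 * pertFun i x) := by
    refine (summable_weight_mul_pow x).tsum_le_tsum (fun i => ?_) (summable_weight_mul_pertFun x x)
    refine mul_le_mul_of_nonneg_left ?_ (weight_pos i).le
    nlinarith [sq_nonneg (pertFun i x ^ 2)]
  unfold energy
  refine add_le_add (mul_le_mul_of_nonneg_left ?_ hK) h2
  linarith

theorem exists_energy_add_smul_le {K : ℝ} (hK : 0 ≤ K) (x y : c₀) :
    ∃ C s₀ : ℝ, 0 < s₀ ∧ ∀ s, |s| ≤ s₀ →
      energy K (x + s • y) ≤ energy K x + s * energyDeriv K x y + C * s ^ 2 := by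
  obtain ⟨N, hN⟩ := exists_forall_abs_coord_le x (by norm_num : (0 : ℝ) < 1 / 2)
  set B := 4 * (‖x‖ + ‖y‖) with hB
  have hB0 : 0 ≤ B := by positivity
  refine ⟨K * ∑ n ∈ Finset.range N, y n ^ 2 + ∑' i, weight i * (11 * B ^ 4),
    min 1 (1 / (2 * (‖y‖ + 1))), by positivity, fun s hs => ?_⟩
  have hs1 : |s| ≤ 1 := hs.trans (min_le_left _ _)
  have hs2 : |s| * ‖y‖ ≤ 1 / 2 := by
    have := hs.trans (min_le_right _ _)
    rw [le_div_iff₀ (by positivity)] at this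
    nlinarith [abs_nonneg s]
  have hfin : ∀ z : c₀, (∀ n, N ≤ n → |z n| ≤ 1) → ∀ b : ℕ → ℝ,
      ∑' n, excess (z n) * b n = ∑ n ∈ Finset.range N, excess (z n) * b n := by
    intro z hz b
    refine tsum_eq_sum fun n hn => ?_
    rw [excess_eq_zero (hz n (by simpa using hn)), zero_mul]
  have hx1 : ∀ n, N ≤ n → |x n| ≤ 1 := fun n hn => (hN n hn).trans (by norm_num)
  have hxy : ∀ n, N ≤ n → |(x + s • y) n| ≤ 1 := by
    intro n hn
    rw [ZeroAtInftyContinuousMap.add_apply, ZeroAtInftyContinuousMap.smul_apply, smul_eq_mul]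
    refine (abs_add_le _ _).trans ?_
    rw [abs_mul]
    have := mul_le_mul_of_nonneg_left (abs_coord_le_norm y n) (abs_nonneg s)
    linarith [hN n hn]
  have h1 : ∑' n, excess ((x + s • y) n) ^ 2 ≤
      ∑' n, excess (x n) ^ 2 + s * excessDeriv x y + s ^ 2 * ∑ n ∈ Finset.range N, y n ^ 2 := by
    simp only [excessDeriv_apply, sq (excess _)]
    rw [hfin _ hxy, hfin _ hx1, hfin _ hx1, Finset.mul_sum, Finset.mul_sum, Finset.mul_sum,
      ← Finset.sum_add_distrib, ← Finset.sum_add_distrib]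
    refine Finset.sum_le_sum fun n _ => ?_
    have := excess_sq_add_le (x n) (s * y n)
    rw [ZeroAtInftyContinuousMap.add_apply, ZeroAtInftyContinuousMap.smul_apply, smul_eq_mul]
    linarith
  have hsB : Summable fun i => weight i * (11 * B ^ 4) := summable_weight.mul_right _
  have h2 : ∑' i, weight i * pertFun i (x + s • y) ^ 4 ≤
      ∑' i, weight i * pertFun i x ^ 4 + s * quarticDeriv x y +
        s ^ 2 * ∑' i, weight i * (11 * B ^ 4) := by
    rw [quarticDeriv_apply, ← tsum_mul_left, ← tsum_mul_left,
      ← (summable_weight_mul_pow x).tsum_add ((summable_weight_mul_pertFun x y).mul_left s),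
      ← ((summable_weight_mul_pow x).add ((summable_weight_mul_pertFun x y).mul_left s)).tsum_add
        (hsB.mul_left _)]
    refine (summable_weight_mul_pow _).tsum_le_tsum (fun i => ?_)
      (((summable_weight_mul_pow x).add ((summable_weight_mul_pertFun x y).mul_left s)).add
        (hsB.mul_left _))
    have ha : |pertFun i x| ≤ B := (abs_pertFun_le i x).trans (by linarith [norm_nonneg y])
    have hb : |pertFun i y| ≤ B := (abs_pertFun_le i y).trans (by linarith [norm_nonneg x])
    rw [map_add, map_smul, smul_eq_mul]
    generalize pertFun i x = a at *
    generalize pertFun i y = b at *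
    have h3 : 6 * a ^ 2 * b ^ 2 + 4 * s * a * b ^ 3 + s ^ 2 * b ^ 4 ≤ 11 * B ^ 4 := by
      calc 6 * a ^ 2 * b ^ 2 + 4 * s * a * b ^ 3 + s ^ 2 * b ^ 4
          ≤ |6 * a ^ 2 * b ^ 2 + 4 * s * a * b ^ 3 + s ^ 2 * b ^ 4| := le_abs_self _
        _ ≤ 6 * |a| ^ 2 * |b| ^ 2 + 4 * |s| * |a| * |b| ^ 3 + |s| ^ 2 * |b| ^ 4 := by
            refine (abs_add_le _ _).trans (add_le_add ((abs_add_le _ _).trans ?_) ?_)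
            · simp [abs_mul, abs_pow]
            · simp [abs_mul, abs_pow]
        _ ≤ 6 * B ^ 2 * B ^ 2 + 4 * 1 * B * B ^ 3 + 1 ^ 2 * B ^ 4 := by gcongr
        _ = 11 * B ^ 4 := by ring
    have h4 : (a + s * b) ^ 4 ≤ a ^ 4 + s * (4 * a ^ 3 * b) + s ^ 2 * (11 * B ^ 4) := by
      nlinarith [mul_le_mul_of_nonneg_left h3 (sq_nonneg s)]
    have := mul_le_mul_of_nonneg_left h4 (weight_pos i).le
    linarith
  rw [energyDeriv_apply]
  unfold energy
  nlinarith [mul_le_mul_of_nonneg_left h1 hK]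

theorem energy_le_one {K : ℝ} {x : c₀} (hx : ‖x‖ ≤ 1) : energy K x ≤ 1 := by
  have h1 : ∑' n, excess (x n) ^ 2 = 0 := by
    rw [← tsum_zero (α := ℝ) (β := ℕ)]
    refine tsum_congr fun n => ?_
    rw [excess_eq_zero ((abs_coord_le_norm x n).trans hx)]
    norm_num
  have h2 : ∑' i, weight i * pertFun i x ^ 4 ≤ ∑' i : Idx, 1 / 2 * (1 / 2) ^ Encodable.encode i := by
    refine (summable_weight_mul_pow x).tsum_le_tsum (fun i => ?_)
      (summable_geometric_two_encode.mul_left _)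
    have h3 : pertFun i x ^ 4 ≤ 256 := by
      have : |pertFun i x| ≤ 4 := (abs_pertFun_le i x).trans (by linarith)
      calc pertFun i x ^ 4 = |pertFun i x| ^ 4 := ((by decide : Even 4).pow_abs _).symm
        _ ≤ 4 ^ 4 := by gcongr
        _ = 256 := by norm_num
    have := mul_le_mul (weight_le i) h3 ((by decide : Even 4).pow_nonneg _) (by positivity)
    linarith
  rw [tsum_mul_left] at h2
  have := tsum_geometric_two_encode_le (ι := Idx)
  rw [energy, h1]
  linarith

theorem norm_le_of_energy_le_one {ε : ℝ} (hε : 0 < ε) {x : c₀} (hx : energy (ε⁻¹ ^ 2) x ≤ 1) :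
    ‖x‖ ≤ 1 + ε := by
  rw [← ZeroAtInftyContinuousMap.norm_toBCF_eq_norm]
  refine (BoundedContinuousFunction.norm_le (by positivity)).2 fun n => ?_
  refine abs_le_of_excess_sq_le hε.le ?_
  have h1 : excess (x n) ^ 2 ≤ ∑' n, excess (x n) ^ 2 :=
    (summable_excess_sq x).le_tsum n fun _ _ => sq_nonneg _
  have h2 : 0 ≤ ∑' i, weight i * pertFun i x ^ 4 :=
    tsum_nonneg fun i => mul_nonneg (weight_pos i).le ((by decide : Even 4).pow_nonneg _)
  have h3 : ε⁻¹ ^ 2 * excess (x n) ^ 2 ≤ 1 := by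
    unfold energy at hx
    nlinarith [mul_le_mul_of_nonneg_left h1 (sq_nonneg ε⁻¹)]
  rwa [inv_pow, inv_mul_le_iff₀ (by positivity), mul_one] at h3

/-- The derivatives of `energy` at three points are linearly independent, unless the points are
pairwise proportional or the dependence is trivial. -/
theorem proportional_of_energyDeriv_relation {K l₁ l₂ l₃ : ℝ} {x₁ x₂ x₃ : c₀} (hl₁ : l₁ ≠ 0)
    (hl₂ : l₂ ≠ 0) (h : ∀ y, l₁ * energyDeriv K x₁ y + l₂ * energyDeriv K x₂ y +
      l₃ * energyDeriv K x₃ y = 0) (j k : ℕ) : x₁ j * x₂ k = x₁ k * x₂ j := by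
  have hex : ∀ x : c₀, ∃ N, ∀ n, N ≤ n → excessDeriv x (unitVec n) = 0 := by
    intro x
    obtain ⟨N, hN⟩ := exists_forall_abs_coord_le x one_pos
    refine ⟨N, fun n hn => ?_⟩
    rw [excessDeriv_apply, tsum_eq_single n, excess_eq_zero (hN n hn), zero_mul, mul_zero]
    intro b hb
    rw [unitVec_apply, if_neg hb, mul_zero]
  obtain ⟨N₁, hN₁⟩ := hex x₁
  obtain ⟨N₂, hN₂⟩ := hex x₂
  obtain ⟨N₃, hN₃⟩ := hex x₃
  have hcube : ∀ i, l₁ * pertFun i x₁ ^ 3 + l₂ * pertFun i x₂ ^ 3 + l₃ * pertFun i x₃ ^ 3 = 0 := by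
    refine eq_zero_of_tsum_pertFun_eq_zero
      (A := |l₁| * (4 * ‖x₁‖) ^ 3 + |l₂| * (4 * ‖x₂‖) ^ 3 + |l₃| * (4 * ‖x₃‖) ^ 3)
      (N := max N₁ (max N₂ N₃)) (fun i => ?_) fun n hn => ?_
    · have hb : ∀ (l : ℝ) (x : c₀), |l * pertFun i x ^ 3| ≤ |l| * (4 * ‖x‖) ^ 3 := by
        intro l x
        rw [abs_mul, abs_pow]
        gcongr
        exact abs_pertFun_le i x
      exact (abs_add_le _ _).trans (add_le_add ((abs_add_le _ _).trans (add_le_add (hb _ _)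
        (hb _ _))) (hb _ _))
    · have h0 := h (unitVec n)
      simp only [max_le_iff] at hn
      simp only [energyDeriv_apply, hN₁ n hn.1, hN₂ n hn.2.1, hN₃ n hn.2.2, mul_zero, zero_add]
        at h0
      have hs := (((summable_weight_mul_pertFun x₁ (unitVec n)).hasSum.mul_left l₁).add
        ((summable_weight_mul_pertFun x₂ (unitVec n)).hasSum.mul_left l₂)).add
        ((summable_weight_mul_pertFun x₃ (unitVec n)).hasSum.mul_left l₃)
      have h1 := (hs.mul_left (1 / 4)).tsum_eq
      simp only [← quarticDeriv_apply] at h1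
      rw [h0, mul_zero] at h1
      rw [← h1]
      refine tsum_congr fun i => ?_
      ring
  have hlim : ∀ (j k : ℕ) (σ : Bool), l₁ * (x₁ j + boolSign σ * x₁ k) ^ 3 +
      l₂ * (x₂ j + boolSign σ * x₂ k) ^ 3 + l₃ * (x₃ j + boolSign σ * x₃ k) ^ 3 = 0 := by
    intro j k σ
    have ht := ((((tendsto_pertFun j k σ x₁).pow 3).const_mul l₁).add
      (((tendsto_pertFun j k σ x₂).pow 3).const_mul l₂)).add
      (((tendsto_pertFun j k σ x₃).pow 3).const_mul l₃)
    simp only [hcube] at ht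
    exact tendsto_nhds_unique ht tendsto_const_nhds
  have haaa : ∀ j, l₁ * x₁ j ^ 3 + l₂ * x₂ j ^ 3 + l₃ * x₃ j ^ 3 = 0 := by
    intro j
    have := hlim j j true
    simp only [boolSign, if_true] at this
    linear_combination this / 8
  have habb : ∀ j k, l₁ * (x₁ j * x₁ k ^ 2) + l₂ * (x₂ j * x₂ k ^ 2) + l₃ * (x₃ j * x₃ k ^ 2) =
      0 := by
    intro j k
    have h1 := hlim j k true
    have h2 := hlim j k false
    simp only [boolSign, if_true, Bool.false_eq_true, if_false] at h1 h2
    linear_combination h1 / 6 + h2 / 6 - haaa j / 3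
  refine det_eq_zero_of_cubic_relation hl₁ hl₂ (haaa j) ?_ (habb j k) (haaa k)
  linear_combination habb k j

/-- For the norm given by `energy`, no nontrivial convex combination of two linearly independent
norm-attaining functionals attains its norm. -/
theorem not_attains_of_seminorm {K : ℝ} (hK : 0 ≤ K) (p : Seminorm ℝ c₀)
    (h1 : ∀ x, energy K x ≤ 1 → p x ≤ 1) (h2 : ∀ x, p x < 1 → energy K x ≤ 1)
    {f g : c₀ →ₗ[ℝ] ℝ} {x₁ x₂ x₃ : c₀} (hx₁ : p x₁ = 1) (hf : ∀ y, |f y| ≤ |f x₁| * p y)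
    (hx₂ : p x₂ = 1) (hg : ∀ y, |g y| ≤ |g x₂| * p y)
    (hfg : ∀ a b : ℝ, (∀ y, a * f y + b * g y = 0) → a = 0 ∧ b = 0) {t : ℝ} (ht0 : 0 < t)
    (ht1 : t < 1) (hx₃ : p x₃ = 1) :
    ¬ ∀ y, |(t • f + (1 - t) • g) y| ≤ |(t • f + (1 - t) • g) x₃| * p y := by
  intro hh
  have attains := eq_smul_of_attains p (energy K) (energyDeriv K) h1 h2 (two_mul_energy_le hK)
    (exists_energy_add_smul_le hK) (energy_le_energyDeriv_self hK)
  obtain ⟨hD₁, e₁⟩ := attains x₁ hx₁ f hf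
  obtain ⟨hD₂, e₂⟩ := attains x₂ hx₂ g hg
  obtain ⟨hD₃, e₃⟩ := attains x₃ hx₃ _ hh
  set m₁ := f x₁ / energyDeriv K x₁ x₁
  set m₂ := g x₂ / energyDeriv K x₂ x₂
  set m₃ := (t • f + (1 - t) • g) x₃ / energyDeriv K x₃ x₃
  have hm₁ : m₁ ≠ 0 := fun h => by
    have := (hfg 1 0 fun y => by rw [e₁, h]; ring).1
    norm_num at this
  have hm₂ : m₂ ≠ 0 := fun h => by
    have := (hfg 0 1 fun y => by rw [e₂, h]; ring).2
    norm_num at this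
  have hprop := proportional_of_energyDeriv_relation (K := K) (l₁ := t * m₁) (l₂ := (1 - t) * m₂)
    (l₃ := -m₃) (x₁ := x₁) (x₂ := x₂) (x₃ := x₃) (mul_ne_zero ht0.ne' hm₁)
    (mul_ne_zero (by linarith) hm₂) (fun y => by
      have h3 := e₃ y
      rw [LinearMap.add_apply, LinearMap.smul_apply, LinearMap.smul_apply, smul_eq_mul,
        smul_eq_mul, e₁, e₂] at h3
      linear_combination h3)
  obtain ⟨j, hj⟩ : ∃ j, x₁ j ≠ 0 := by
    by_contra! h
    have h0 : x₁ = 0 := ZeroAtInftyContinuousMap.ext h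
    rw [h0, map_zero] at hx₁
    exact zero_ne_one hx₁
  have hx₂₁ : x₂ = (x₂ j / x₁ j) • x₁ := by
    ext k
    rw [ZeroAtInftyContinuousMap.smul_apply, smul_eq_mul]
    field_simp
    linarith [hprop j k]
  have hc : |x₂ j / x₁ j| = 1 := by
    rwa [hx₂₁, map_smul_eq_mul, hx₁, mul_one, Real.norm_eq_abs] at hx₂
  have hgx : |g x₂| = |g x₁| := by
    rw [hx₂₁, map_smul, smul_eq_mul, abs_mul, hc, one_mul]
  obtain ⟨-, e₄⟩ := attains x₁ hx₁ g (by rwa [hgx] at hg)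
  exact hm₁ (neg_eq_zero.1 (hfg (g x₁ / energyDeriv K x₁ x₁) (-m₁) fun y => by
    rw [e₁, e₄ y]; ring).2)


/-- For every `ε > 0` there exist a real Banach space `X` and a continuous linear bijection
`T : X → c₀` with `‖x‖ ≤ ‖T x‖ ≤ (1 + ε) * ‖x‖` for all `x`, such that whenever
`f, g ∈ NA(X, ℝ)` are linearly independent and `0 < t < 1`, the functional
`t • f + (1 - t) • g` is not norm-attaining. -/
theorem statement4 (ε : ℝ) (hε : 0 < ε) :
    ∃ (X : Type) (_ : NormedAddCommGroup X) (_ : NormedSpace ℝ X) (_ : CompleteSpace X)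
      (T : X →L[ℝ] ZeroAtInftyContinuousMap ℕ ℝ),
      Function.Bijective T ∧
      (∀ x : X, ‖x‖ ≤ ‖T x‖ ∧ ‖T x‖ ≤ (1 + ε) * ‖x‖) ∧
      ∀ f g : X →L[ℝ] ℝ,
        (∃ x : X, ‖x‖ = 1 ∧ |f x| = ‖f‖) →
        (∃ x : X, ‖x‖ = 1 ∧ |g x| = ‖g‖) →
        LinearIndependent ℝ ![f, g] →
        ∀ t : ℝ, 0 < t → t < 1 →
          ¬ ∃ x : X, ‖x‖ = 1 ∧ |(t • f + (1 - t) • g) x| = ‖t • f + (1 - t) • g‖ := by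
  obtain ⟨p, hp, h1, h2⟩ := exists_seminorm hε (convexOn_energy (sq_nonneg ε⁻¹))
    (energy_neg _) (fun _ => energy_le_one) (fun _ => norm_le_of_energy_le_one hε)
  obtain ⟨X, G, S, hX, T, hT, hTp⟩ := exists_renorming p ε hp
  refine ⟨X, G, S, hX, T, hT, fun x => by rw [hTp]; exact hp (T x), ?_⟩
  rintro f g ⟨x₁, hx₁, hf⟩ ⟨x₂, hx₂, hg⟩ hfg t ht0 ht1 ⟨x₃, hx₃, hh⟩
  let e : X ≃ₗ[ℝ] ZeroAtInftyContinuousMap ℕ ℝ := LinearEquiv.ofBijective T.toLinearMap hT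
  have he : ∀ x, e x = T x := fun _ => rfl
  have hpe : ∀ y, p y = ‖e.symm y‖ := fun y => by rw [hTp, ← he, e.apply_symm_apply]
  have hbound : ∀ (u : X →L[ℝ] ℝ) (x : X), |u x| = ‖u‖ →
      ∀ y, |u (e.symm y)| ≤ |u (e.symm (e x))| * p y := by
    intro u x hu y
    rw [e.symm_apply_apply, hu, hpe]
    exact u.le_opNorm _
  refine not_attains_of_seminorm (sq_nonneg ε⁻¹) p h1 h2
    (f := f.toLinearMap ∘ₗ e.symm.toLinearMap) (g := g.toLinearMap ∘ₗ e.symm.toLinearMap)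
    (x₁ := e x₁) (x₂ := e x₂) (x₃ := e x₃) (by rw [he, ← hTp, hx₁]) (hbound f x₁ hf)
    (by rw [he, ← hTp, hx₂]) (hbound g x₂ hg) (fun a b hab => ?_) ht0 ht1
    (by rw [he, ← hTp, hx₃]) (hbound _ x₃ hh)
  refine LinearIndependent.pair_iff.1 hfg a b (ContinuousLinearMap.ext fun x => ?_)
  simpa using hab (e x)
end

section
/- There exists an infinite-dimensional real Banach space X such that (i) whenever f, g ∈ NA(X,ℝ) are linearly independent and 0 < t < 1, the functional t·f + (1−t)·g is not norm-attaining, and (ii) the bidual X** is a strictly convex normed space; in particular X itself is strictly convex. -/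
open Filter Topology
open scoped BoundedContinuousFunction

namespace ExtremelyNonlineable

/-- A convex `C¹` function vanishing exactly on `[-1, 1]`. -/
noncomputable def flat (s : ℝ) : ℝ := max (s - 1) 0 ^ 2 + max (-s - 1) 0 ^ 2

/-- The derivative of `flat`. -/
noncomputable def flatSlope (s : ℝ) : ℝ := 2 * max (s - 1) 0 - 2 * max (-s - 1) 0

lemma flat_nonneg (s : ℝ) : 0 ≤ flat s := by unfold flat; positivity

lemma flat_neg (s : ℝ) : flat (-s) = flat s := by unfold flat; rw [neg_neg, add_comm]

lemma flat_eq_zero {s : ℝ} (hs : |s| ≤ 1) : flat s = 0 := by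
  rw [abs_le] at hs
  rw [flat, max_eq_right (by linarith), max_eq_right (by linarith)]
  norm_num

lemma flatSlope_eq_zero {s : ℝ} (hs : |s| ≤ 1) : flatSlope s = 0 := by
  rw [abs_le] at hs
  rw [flatSlope, max_eq_right (by linarith), max_eq_right (by linarith)]
  norm_num

lemma abs_le_two_of_flat_le_one {s : ℝ} (hs : flat s ≤ 1) : |s| ≤ 2 := by
  unfold flat at hs
  have h₁ := le_max_left (s - 1) 0
  have h₂ := le_max_right (s - 1) 0
  have h₃ := le_max_left (-s - 1) 0
  have h₄ := le_max_right (-s - 1) 0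
  rw [abs_le]
  constructor <;> nlinarith

lemma continuous_flat : Continuous flat := by unfold flat; fun_prop

lemma convexOn_flat : ConvexOn ℝ Set.univ flat := by
  have h₁ : ConvexOn ℝ Set.univ fun s : ℝ => max (s - 1) 0 :=
    ((convexOn_id convex_univ).sub (concaveOn_const 1 convex_univ)).sup
      (convexOn_const 0 convex_univ)
  have h₂ : ConvexOn ℝ Set.univ fun s : ℝ => max (-s - 1) 0 :=
    ((concaveOn_id convex_univ).neg.sub (concaveOn_const 1 convex_univ)).sup
      (convexOn_const 0 convex_univ)
  exact (h₁.pow (fun s _ => le_max_right _ _) 2).add (h₂.pow (fun s _ => le_max_right _ _) 2)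

lemma flat_add_le (s h : ℝ) : flat (s + h) ≤ flat s + flatSlope s * h + 2 * h ^ 2 := by
  have key (a h : ℝ) : max (a + h) 0 ^ 2 ≤ max a 0 ^ 2 + 2 * max a 0 * h + h ^ 2 := by
    have h₁ := le_max_left a 0
    rcases le_total (a + h) 0 with h₀ | h₀
    · rw [max_eq_right h₀]
      nlinarith [sq_nonneg (max a 0 + h)]
    · rw [max_eq_left h₀]
      nlinarith
  have h₁ := key (s - 1) h
  have h₂ := key (-s - 1) (-h)
  rw [flat, flat, flatSlope, show s + h - 1 = s - 1 + h by ring,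
    show -(s + h) - 1 = -s - 1 + -h by ring]
  linarith

lemma flatSlope_mul_self_nonneg (s : ℝ) : 0 ≤ flatSlope s * s := by
  unfold flatSlope
  rcases le_total s 0 with hs | hs
  · rw [max_eq_right (by linarith : s - 1 ≤ 0)]
    nlinarith [le_max_right (-s - 1) 0]
  · rw [max_eq_right (by linarith : -s - 1 ≤ 0)]
    nlinarith [le_max_right (s - 1) 0]

lemma flatSlope_mul_self_pos {s : ℝ} (hs : 1 < |s|) : 0 < flatSlope s * s := by
  unfold flatSlope
  rcases lt_abs.1 hs with hs | hs
  · rw [max_eq_right (by linarith : -s - 1 ≤ 0), max_eq_left (by linarith)]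
    nlinarith
  · rw [max_eq_right (by linarith : s - 1 ≤ 0), max_eq_left (by linarith)]
    nlinarith

/-- The unit ball of the Luxemburg norm of `flat` on `ℓ^∞`. -/
def luxBall : Set (ℕ →ᵇ ℝ) := {s | ∀ N, ∑ k ∈ Finset.range N, flat (s k) ≤ 1}

lemma convex_luxBall : Convex ℝ luxBall := by
  intro x hx y hy a b ha hb hab N
  calc ∑ k ∈ Finset.range N, flat ((a • x + b • y) k)
      ≤ ∑ k ∈ Finset.range N, (a * flat (x k) + b * flat (y k)) :=
        Finset.sum_le_sum fun k _ => convexOn_flat.2 trivial trivial ha hb hab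
    _ = a * ∑ k ∈ Finset.range N, flat (x k) + b * ∑ k ∈ Finset.range N, flat (y k) := by
        rw [Finset.sum_add_distrib, Finset.mul_sum, Finset.mul_sum]
    _ ≤ 1 := by nlinarith [hx N, hy N]

lemma closedBall_subset_luxBall : Metric.closedBall 0 1 ⊆ luxBall := by
  intro x hx N
  rw [Finset.sum_eq_zero fun k _ => flat_eq_zero ?_]
  · norm_num
  · exact (x.norm_coe_le_norm k).trans (mem_closedBall_zero_iff.1 hx)

lemma luxBall_mem_nhds : luxBall ∈ 𝓝 0 :=
  mem_of_superset (Metric.closedBall_mem_nhds 0 one_pos) closedBall_subset_luxBall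

lemma isClosed_luxBall : IsClosed luxBall := by
  simp only [luxBall, Set.ofPred_forall]
  refine isClosed_iInter fun N => isClosed_le ?_ continuous_const
  exact continuous_finsetSum _ fun k _ =>
    continuous_flat.comp (BoundedContinuousFunction.evalCLM ℝ k).continuous

lemma neg_mem_luxBall : ∀ x ∈ luxBall, -x ∈ luxBall := by
  intro x hx N
  simpa [flat_neg] using hx N

/-- The Luxemburg norm of `flat` on `ℓ^∞`. -/
noncomputable def lux : Seminorm ℝ (ℕ →ᵇ ℝ) :=
  gaugeSeminorm (𝕜 := ℝ) (balanced_iff_neg_mem convex_luxBall |>.2 fun {x} => neg_mem_luxBall x)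
    convex_luxBall
    (absorbent_nhds_zero luxBall_mem_nhds)

lemma continuous_lux : Continuous lux :=
  continuous_gauge convex_luxBall luxBall_mem_nhds

lemma lux_le_one_iff {x : ℕ →ᵇ ℝ} : lux x ≤ 1 ↔ x ∈ luxBall := by
  rw [← isClosed_luxBall.closure_eq]
  exact gauge_le_one_iff_mem_closure convex_luxBall luxBall_mem_nhds

lemma lux_le_iff {x : ℕ →ᵇ ℝ} {c : ℝ} (hc : 0 < c) :
    lux x ≤ c ↔ ∀ N, ∑ k ∈ Finset.range N, flat (x k / c) ≤ 1 := by
  have h : lux (c⁻¹ • x) = lux x / c := by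
    rw [map_smul_eq_mul, Real.norm_of_nonneg (by positivity)]; ring
  rw [← div_le_one hc, ← h, lux_le_one_iff]
  simp [luxBall, div_eq_inv_mul]

lemma lux_le_norm (x : ℕ →ᵇ ℝ) : lux x ≤ ‖x‖ := by
  refine le_of_forall_pos_le_add fun ε hε => ?_
  have hc : 0 < ‖x‖ + ε := by positivity
  refine (lux_le_iff hc).2 fun N => ?_
  rw [Finset.sum_eq_zero fun k _ => flat_eq_zero ?_]
  · norm_num
  · rw [abs_div, abs_of_pos hc, div_le_one hc]
    exact (x.norm_coe_le_norm k).trans (by linarith)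

lemma abs_apply_le_lux (x : ℕ →ᵇ ℝ) (k : ℕ) : |x k| ≤ 2 * lux x := by
  refine le_of_forall_pos_le_add fun ε hε => ?_
  have hc : 0 < lux x + ε / 2 := by have := apply_nonneg lux x; positivity
  have h := (lux_le_iff hc).1 (by linarith : lux x ≤ lux x + ε / 2) (k + 1)
  have h₁ : flat (x k / (lux x + ε / 2)) ≤ 1 :=
    (Finset.single_le_sum (f := fun k => flat (x k / (lux x + ε / 2)))
      (fun i _ => flat_nonneg _) (Finset.self_mem_range_succ k)).trans h
  have h₂ := abs_le_two_of_flat_le_one h₁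
  rw [abs_div, abs_of_pos hc, div_le_iff₀ hc] at h₂
  linarith

lemma norm_le_lux (x : ℕ →ᵇ ℝ) : ‖x‖ ≤ 2 * lux x :=
  (BoundedContinuousFunction.norm_le (by have := apply_nonneg lux x; positivity)).2
    (abs_apply_le_lux x)

/-- The sequence supported on `{k}` with value one. -/
noncomputable def unitSeq (k : ℕ) : ℕ →ᵇ ℝ :=
  BoundedContinuousFunction.ofNormedAddCommGroupDiscrete (Pi.single k 1) 1 fun n => by
    by_cases h : n = k
    · subst h; simp
    · simp [h]

@[simp] lemma unitSeq_apply (k n : ℕ) : unitSeq k n = if n = k then 1 else 0 := by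
  simp [unitSeq, Pi.single_apply]

/-- The truncation of a sequence to its first `M` entries. -/
noncomputable def trunc (M : ℕ) (s : ℕ →ᵇ ℝ) : ℕ →ᵇ ℝ :=
  ∑ k ∈ Finset.range M, s k • unitSeq k

@[simp] lemma trunc_apply (M : ℕ) (s : ℕ →ᵇ ℝ) (n : ℕ) :
    trunc M s n = if n < M then s n else 0 := by
  simp [trunc]

lemma lux_trunc_le (M : ℕ) (s : ℕ →ᵇ ℝ) : lux (trunc M s) ≤ lux s := by
  refine le_of_forall_pos_le_add fun ε hε => ?_
  have hc : 0 < lux s + ε := by have := apply_nonneg lux s; positivity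
  refine (lux_le_iff hc).2 fun N => le_trans (Finset.sum_le_sum fun k _ => ?_)
    ((lux_le_iff hc).1 (by linarith : lux s ≤ lux s + ε) N)
  rw [trunc_apply]
  split_ifs
  · rfl
  · simpa [flat_eq_zero] using flat_nonneg _

lemma lux_le_of_trunc {s : ℕ →ᵇ ℝ} {c : ℝ} (hc : 0 ≤ c) (h : ∀ M, lux (trunc M s) ≤ c) :
    lux s ≤ c := by
  refine le_of_forall_pos_le_add fun ε hε => ?_
  have hc : 0 < c + ε := by positivity
  refine (lux_le_iff hc).2 fun N => ?_
  refine le_trans (le_of_eq (Finset.sum_congr rfl fun k hk => ?_))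
    ((lux_le_iff hc).1 ((h N).trans (by linarith)) N)
  rw [trunc_apply, if_pos (Finset.mem_range.1 hk)]

/-- The norm `lux` is differentiable at non-zero null sequences, and its derivative is finitely
supported: it decreases in every direction where a suitable finitely supported functional is
negative. -/
lemma exists_lux_slope {x : ℕ →ᵇ ℝ} (hx : Tendsto x atTop (𝓝 0)) (hx₀ : x ≠ 0) :
    ∃ L : (ℕ →ᵇ ℝ) →ₗ[ℝ] ℝ, L x = 1 ∧ (∃ K, ∀ k ≥ K, L (unitSeq k) = 0) ∧
      ∀ z : ℕ →ᵇ ℝ, Tendsto z atTop (𝓝 0) → L z < 0 →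
        ∀ᶠ t in 𝓝[>] (0 : ℝ), lux (x + t • z) ≤ lux x := by
  set β := lux x with hβ
  have hβ₀ : 0 < β := by
    have := norm_le_lux x
    have := norm_pos_iff.2 hx₀
    linarith
  have hle := (lux_le_iff hβ₀).1 le_rfl
  have bound (z : ℕ →ᵇ ℝ) (hz : Tendsto z atTop (𝓝 0)) : ∃ K₀, ∀ K ≥ K₀, ∀ t ∈ Set.Ioc (0 : ℝ) 1,
      ∀ N, ∑ k ∈ Finset.range N, flat ((x + t • z) k / β) ≤
        ∑ k ∈ Finset.range K, flat (x k / β) +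
          t / β * ∑ k ∈ Finset.range K, flatSlope (x k / β) * z k +
            t ^ 2 * (∑ k ∈ Finset.range K, 2 * (z k / β) ^ 2) := by
    have hev : ∀ᶠ k in atTop, |x k| + |z k| < β := by
      have h := hx.abs.add hz.abs
      simp only [abs_zero, add_zero] at h
      exact h.eventually_lt_const hβ₀
    obtain ⟨K₀, hK₀⟩ := eventually_atTop.1 hev
    refine ⟨K₀, fun K hK t ht N => ?_⟩
    have hzero : ∀ k ≥ K, flat ((x + t • z) k / β) = 0 := fun k hk => flat_eq_zero (by
      rw [abs_div, abs_of_pos hβ₀, div_le_one hβ₀]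
      refine le_trans ?_ (hK₀ k (hK.trans hk)).le
      refine (abs_add_le _ _).trans (add_le_add_right ?_ _)
      change |t * z k| ≤ |z k|
      rw [abs_mul, abs_of_pos ht.1]
      exact mul_le_of_le_one_left (abs_nonneg _) ht.2)
    have h₁ : ∑ k ∈ Finset.range N, flat ((x + t • z) k / β) ≤
        ∑ k ∈ Finset.range K, flat ((x + t • z) k / β) := by
      rcases le_total N K with h | h
      · exact Finset.sum_le_sum_of_subset_of_nonneg (Finset.range_mono h)
          fun _ _ _ => flat_nonneg _
      · refine le_of_eq (Finset.sum_subset (Finset.range_mono h) fun k _ hk => ?_).symm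
        exact hzero k (by simpa using hk)
    refine h₁.trans ?_
    rw [Finset.mul_sum, Finset.mul_sum, ← Finset.sum_add_distrib, ← Finset.sum_add_distrib]
    refine Finset.sum_le_sum fun k _ => ?_
    have h₂ := flat_add_le (x k / β) (t * z k / β)
    have h₃ : (x + t • z) k / β = x k / β + t * z k / β := by simp; ring
    rw [h₃]
    refine h₂.trans (le_of_eq ?_)
    ring
  obtain ⟨K₁, hK₁⟩ : ∃ K, ∀ k ≥ K, |x k| ≤ β := by
    have h := hx.abs
    rw [abs_zero] at h
    exact eventually_atTop.1 ((h.eventually_lt_const hβ₀).mono fun _ => le_of_lt)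
  have hslope : ∀ k ≥ K₁, flatSlope (x k / β) = 0 := fun k hk => flatSlope_eq_zero (by
    rw [abs_div, abs_of_pos hβ₀, div_le_one hβ₀]; exact hK₁ k hk)
  have hext (z : ℕ →ᵇ ℝ) {K : ℕ} (hK : K₁ ≤ K) :
      ∑ k ∈ Finset.range K, flatSlope (x k / β) * z k =
        ∑ k ∈ Finset.range K₁, flatSlope (x k / β) * z k :=
    (Finset.sum_subset (Finset.range_mono hK) fun k _ hk => by
      rw [hslope k (by simpa using hk), zero_mul]).symm
  set D := ∑ k ∈ Finset.range K₁, flatSlope (x k / β) * x k with hD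
  have small (a : ℝ) {b c : ℝ} (h : a < b) : ∀ᶠ t in 𝓝[>] (0 : ℝ), a + t * c < b := by
    have : Tendsto (fun t : ℝ => a + t * c) (𝓝[>] 0) (𝓝 (a + 0 * c)) := by
      apply Tendsto.mono_left _ nhdsWithin_le_nhds
      exact (by fun_prop : Continuous fun t : ℝ => a + t * c).tendsto 0
    exact this.eventually_lt_const (by linarith)
  have hterm (k : ℕ) : flatSlope (x k / β) * x k = β * (flatSlope (x k / β) * (x k / β)) := by
    field_simp
  have hDpos : 0 < D := by
    by_contra hcon
    have hterm_nonneg (k : ℕ) : 0 ≤ flatSlope (x k / β) * x k := by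
      rw [hterm]; exact mul_nonneg hβ₀.le (flatSlope_mul_self_nonneg _)
    have hbd (k : ℕ) : |x k / β| ≤ 1 := by
      by_contra! hk
      rcases le_or_gt K₁ k with h | h
      · rw [abs_div, abs_of_pos hβ₀, one_lt_div hβ₀] at hk
        linarith [hK₁ k h]
      · apply hcon
        refine Finset.sum_pos' (fun _ _ => hterm_nonneg _) ⟨k, Finset.mem_range.2 h, ?_⟩
        rw [hterm]
        exact mul_pos hβ₀ (flatSlope_mul_self_pos hk)
    obtain ⟨K₀, hK₀⟩ := bound x hx
    set C := ∑ k ∈ Finset.range K₀, 2 * (x k / β) ^ 2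
    obtain ⟨t, ht, ht₁, ht₂⟩ := ((eventually_mem_nhdsWithin).and
      ((small 0 one_pos (c := C)).and (small 0 one_pos (c := 1)))).exists
    have ht₀ : 0 < t := ht
    have h : lux (x + t • x) ≤ β := (lux_le_iff hβ₀).2 fun N => by
      refine (hK₀ K₀ le_rfl t ⟨ht, by linarith⟩ N).trans ?_
      rw [Finset.sum_eq_zero (fun k _ => flat_eq_zero (hbd k)),
        Finset.sum_eq_zero (fun k _ => by rw [flatSlope_eq_zero (hbd k), zero_mul])]
      have hC : 0 ≤ C := Finset.sum_nonneg fun _ _ => by positivity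
      nlinarith
    have h' : x + t • x = (1 + t) • x := by rw [add_smul, one_smul]
    rw [h', map_smul_eq_mul, Real.norm_of_nonneg (by positivity), ← hβ] at h
    nlinarith
  let L : (ℕ →ᵇ ℝ) →ₗ[ℝ] ℝ :=
    { toFun z := D⁻¹ * ∑ k ∈ Finset.range K₁, flatSlope (x k / β) * z k
      map_add' z w := by simp [mul_add, Finset.sum_add_distrib]
      map_smul' c z := by
        simp only [BoundedContinuousFunction.coe_smul, smul_eq_mul, RingHom.id_apply,
          Finset.mul_sum]
        exact Finset.sum_congr rfl fun _ _ => by ring }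
  refine ⟨L, inv_mul_cancel₀ hDpos.ne', ⟨K₁, fun k hk => ?_⟩, fun z hz hLz => ?_⟩
  · change D⁻¹ * _ = 0
    rw [Finset.sum_eq_zero, mul_zero]
    intro n hn
    rw [unitSeq_apply, if_neg (by have := Finset.mem_range.1 hn; omega), mul_zero]
  · have hneg : ∑ k ∈ Finset.range K₁, flatSlope (x k / β) * z k < 0 := by
      by_contra! h
      exact absurd hLz (not_lt.2 (mul_nonneg (inv_nonneg.2 hDpos.le) h))
    obtain ⟨K₀, hK₀⟩ := bound z hz
    have hb := hK₀ (max K₀ K₁) (le_max_left _ _)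
    rw [hext z (le_max_right K₀ K₁)] at hb
    set C := ∑ k ∈ Finset.range (max K₀ K₁), 2 * (z k / β) ^ 2
    set A := ∑ k ∈ Finset.range K₁, flatSlope (x k / β) * z k
    have hA : A / β < 0 := div_neg_of_neg_of_pos hneg hβ₀
    filter_upwards [eventually_mem_nhdsWithin, small (A / β) hA (c := C),
      small 0 one_pos (c := 1)] with t ht ht₁ ht₂
    have ht₀ : 0 < t := ht
    refine (lux_le_iff hβ₀).2 fun N => (hb t ⟨ht, by linarith⟩ N).trans ?_
    have h₁ := hle (max K₀ K₁)
    have h₂ : t / β * A + t ^ 2 * C = t * (A / β + t * C) := by ring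
    nlinarith

/-- An infinitely supported tail, with disjoint supports for different `n`. -/
noncomputable def tail (n : ℕ) (s : ℕ →ᵇ ℝ) : ℝ :=
  ∑' l, (1 / 2 : ℝ) ^ Nat.pair n l * s (Nat.pair n l)

lemma abs_tail_term_le (n l : ℕ) (s : ℕ →ᵇ ℝ) :
    |(1 / 2 : ℝ) ^ Nat.pair n l * s (Nat.pair n l)| ≤ (1 / 2) ^ n * ‖s‖ * (1 / 2) ^ l := by
  rw [abs_mul, abs_of_pos (by positivity : (0 : ℝ) < (1 / 2) ^ Nat.pair n l)]
  calc (1 / 2 : ℝ) ^ Nat.pair n l * |s (Nat.pair n l)|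
      ≤ (1 / 2 : ℝ) ^ (n + l) * ‖s‖ :=
        mul_le_mul (pow_le_pow_of_le_one (by norm_num) (by norm_num) (Nat.add_le_pair n l))
          (s.norm_coe_le_norm _) (abs_nonneg _) (by positivity)
    _ = _ := by rw [pow_add]; ring

lemma summable_tail (n : ℕ) (s : ℕ →ᵇ ℝ) :
    Summable fun l => (1 / 2 : ℝ) ^ Nat.pair n l * s (Nat.pair n l) :=
  .of_norm_bounded (summable_geometric_two.mul_left _) fun l => abs_tail_term_le n l s

lemma abs_tail_le (n : ℕ) (s : ℕ →ᵇ ℝ) : |tail n s| ≤ (1 / 2) ^ n * ‖s‖ * 2 :=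
  tsum_of_norm_bounded (f := fun l => (1 / 2 : ℝ) ^ Nat.pair n l * s (Nat.pair n l))
    (hasSum_geometric_two.mul_left _) fun l => abs_tail_term_le n l s

/-- A sequence of functionals on `ℓ^∞`, coming from `ℓ¹`. Each functional
`s ↦ s i + s j / (q + 1)` is a limit of a subsequence, but modulo finitely supported functionals
the `probe n` have disjoint infinite supports. -/
noncomputable def probe (n : ℕ) : (ℕ →ᵇ ℝ) →L[ℝ] ℝ :=
  LinearMap.mkContinuous
    { toFun s := s n.unpair.1.unpair.1 + 1 / ((n.unpair.2.unpair.1 : ℝ) + 1) *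
        s n.unpair.1.unpair.2 + tail n s
      map_add' s t := by
        have : tail n (s + t) = tail n s + tail n t := by
          rw [tail, tail, tail, ← (summable_tail n s).tsum_add (summable_tail n t)]
          exact tsum_congr fun l => mul_add _ _ _
        rw [this, BoundedContinuousFunction.add_apply, BoundedContinuousFunction.add_apply]
        ring
      map_smul' c s := by
        have : tail n (c • s) = c * tail n s := by
          rw [tail, tail, ← tsum_mul_left]
          exact tsum_congr fun l => mul_left_comm _ _ _
        rw [this, BoundedContinuousFunction.smul_apply, BoundedContinuousFunction.smul_apply,
          smul_eq_mul, smul_eq_mul, RingHom.id_apply, smul_eq_mul]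
        ring } 4 fun s => by
    have h₁ := s.norm_coe_le_norm n.unpair.1.unpair.1
    have h₂ : |1 / ((n.unpair.2.unpair.1 : ℝ) + 1) * s n.unpair.1.unpair.2| ≤ ‖s‖ := by
      rw [abs_mul, abs_of_pos (by positivity)]
      refine (mul_le_of_le_one_left (abs_nonneg _) ?_).trans (s.norm_coe_le_norm _)
      rw [div_le_one (by positivity)]
      simp
    have h₃ : |tail n s| ≤ 2 * ‖s‖ := by
      have h := pow_le_one₀ (by norm_num : (0 : ℝ) ≤ 1 / 2) (by norm_num) (n := n)
      nlinarith [abs_tail_le n s, norm_nonneg s]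
    change |s n.unpair.1.unpair.1 + 1 / ((n.unpair.2.unpair.1 : ℝ) + 1) *
        s n.unpair.1.unpair.2 + tail n s| ≤ _
    refine (abs_add_three _ _ _).trans ?_
    rw [Real.norm_eq_abs] at h₁
    linarith

lemma probe_apply (n : ℕ) (s : ℕ →ᵇ ℝ) :
    probe n s = s n.unpair.1.unpair.1 + 1 / ((n.unpair.2.unpair.1 : ℝ) + 1) *
        s n.unpair.1.unpair.2 + tail n s := rfl

lemma abs_probe_le (n : ℕ) (s : ℕ →ᵇ ℝ) : |probe n s| ≤ 4 * ‖s‖ :=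
  ((probe n).le_opNorm s).trans
    (mul_le_mul_of_nonneg_right (LinearMap.mkContinuous_norm_le _ (by norm_num) _) (norm_nonneg _))

lemma tendsto_probe_pair (i j q : ℕ) (s : ℕ →ᵇ ℝ) :
    Tendsto (fun m => probe (Nat.pair (Nat.pair i j) (Nat.pair q m)) s) atTop
      (𝓝 (s i + 1 / ((q : ℝ) + 1) * s j)) := by
  simp only [probe_apply, Nat.unpair_pair]
  nth_rewrite 2 [← add_zero (s i + 1 / ((q : ℝ) + 1) * s j)]
  refine tendsto_const_nhds.add (squeeze_zero_norm (a := fun m => (1 / 2) ^ m * (‖s‖ * 2))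
    (fun m => (abs_tail_le _ s).trans ?_) ?_)
  · rw [mul_assoc]
    refine mul_le_mul_of_nonneg_right ?_ (by positivity)
    exact pow_le_pow_of_le_one (by norm_num) (by norm_num)
      ((Nat.right_le_pair q m).trans (Nat.right_le_pair _ _))
  · simpa using (tendsto_pow_atTop_nhds_zero_of_lt_one (by norm_num : (0 : ℝ) ≤ 1 / 2)
      (by norm_num)).mul_const (‖s‖ * 2)

lemma eq_zero_of_probe_eq_zero {s : ℕ →ᵇ ℝ} (h : ∀ n, probe n s = 0) : s = 0 := by
  ext i
  have h₁ := tendsto_probe_pair i i 0 s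
  simp only [h] at h₁
  have h₂ := tendsto_nhds_unique h₁ tendsto_const_nhds
  simp only [Nat.cast_zero, zero_add, div_one, one_mul] at h₂
  simpa using h₂

lemma probe_unitSeq_of_lt {n k : ℕ} (hn : n < k) (hk : k.unpair.1 ≠ n) :
    probe n (unitSeq k) = 0 := by
  have h₁ : n.unpair.1.unpair.1 ≠ k :=
    (((Nat.unpair_left_le _).trans (Nat.unpair_left_le _)).trans_lt hn).ne
  have h₂ : n.unpair.1.unpair.2 ≠ k :=
    (((Nat.unpair_right_le _).trans (Nat.unpair_left_le _)).trans_lt hn).ne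
  have h₃ : tail n (unitSeq k) = 0 := by
    refine (tsum_congr fun l => ?_).trans tsum_zero
    rw [unitSeq_apply, if_neg, mul_zero]
    rintro rfl
    simp at hk
  rw [probe_apply, h₃, unitSeq_apply, unitSeq_apply, if_neg h₁, if_neg h₂]
  simp

lemma probe_unitSeq_pair {n l : ℕ} (hn : n < l) :
    probe n (unitSeq (Nat.pair n l)) = (1 / 2) ^ Nat.pair n l := by
  have hk : n < Nat.pair n l := hn.trans_le (Nat.right_le_pair n l)
  have h₁ : n.unpair.1.unpair.1 ≠ Nat.pair n l :=
    (((Nat.unpair_left_le _).trans (Nat.unpair_left_le _)).trans_lt hk).ne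
  have h₂ : n.unpair.1.unpair.2 ≠ Nat.pair n l :=
    (((Nat.unpair_right_le _).trans (Nat.unpair_left_le _)).trans_lt hk).ne
  have h₃ : tail n (unitSeq (Nat.pair n l)) = (1 / 2) ^ Nat.pair n l := by
    rw [tail, tsum_eq_single l]
    · simp
    · intro m hm
      rw [unitSeq_apply, if_neg, mul_zero]
      simpa using hm
  rw [probe_apply, h₃, unitSeq_apply, unitSeq_apply, if_neg h₁, if_neg h₂]
  simp

lemma norm_unitSeq_le (k : ℕ) : ‖unitSeq k‖ ≤ 1 :=
  (BoundedContinuousFunction.norm_le zero_le_one).2 fun n => by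
    rw [unitSeq_apply]
    split_ifs <;> simp

lemma norm_trunc_le (M : ℕ) (s : ℕ →ᵇ ℝ) : ‖trunc M s‖ ≤ ‖s‖ :=
  (BoundedContinuousFunction.norm_le (norm_nonneg _)).2 fun k => by
    rw [trunc_apply]
    split_ifs
    · exact s.norm_coe_le_norm k
    · simp

lemma tendsto_trunc_apply (s : ℕ →ᵇ ℝ) (k : ℕ) :
    Tendsto (fun M => trunc M s k) atTop (𝓝 (s k)) :=
  tendsto_const_nhds.congr' <| (eventually_gt_atTop k).mono fun M hM => by
    simp only [trunc_apply, if_pos hM]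

lemma tendsto_probe_trunc (n : ℕ) (s : ℕ →ᵇ ℝ) :
    Tendsto (fun M => probe n (trunc M s)) atTop (𝓝 (probe n s)) := by
  simp only [probe_apply]
  refine ((tendsto_trunc_apply s _).add ((tendsto_trunc_apply s _).const_mul _)).add ?_
  refine tendsto_tsum_of_dominated_convergence (bound := fun l => (1 / 2) ^ n * ‖s‖ * (1 / 2) ^ l)
    (summable_geometric_two.mul_left _) (fun l => (tendsto_trunc_apply s _).const_mul _)
    (.of_forall fun M l => (abs_tail_term_le n l _).trans ?_)
  have := norm_trunc_le M s
  gcongr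

lemma summable_weight : Summable fun n : ℕ => (1 / 8 : ℝ) ^ n :=
  summable_geometric_of_lt_one (by norm_num) (by norm_num)

lemma summable_weight_mul {ζ : ℕ → ℝ} {C : ℝ} (hζ : ∀ n, |ζ n| ≤ C) :
    Summable fun n => (1 / 8 : ℝ) ^ n * ζ n :=
  .of_norm_bounded (summable_weight.mul_right C) fun n => by
    rw [norm_mul, norm_pow, Real.norm_of_nonneg (by norm_num)]
    exact mul_le_mul_of_nonneg_left (hζ n) (by positivity)

/-- A bounded combination of the functionals `probe n` is finitely supported only if it is
trivial. -/
lemma eq_zero_of_finite_support {ζ : ℕ → ℝ} {C : ℝ} (hζ : ∀ n, |ζ n| ≤ C) {K : ℕ}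
    (h : ∀ k ≥ K, ∑' n, (1 / 8 : ℝ) ^ n * (ζ n * probe n (unitSeq k)) = 0) (m : ℕ) : ζ m = 0 := by
  have hC : 0 ≤ C := (abs_nonneg _).trans (hζ 0)
  have hbd (k n : ℕ) : |ζ n * probe n (unitSeq k)| ≤ C * 4 := by
    rw [abs_mul]
    refine mul_le_mul (hζ n) ?_ (abs_nonneg _) hC
    linarith [abs_probe_le n (unitSeq k), norm_unitSeq_le k]
  have main (l : ℕ) (hK : K ≤ l) (hm : m < l) : |(1 / 8) ^ m * ζ m| ≤ 8 * C * (1 / 2) ^ l := by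
    set k := Nat.pair m l with hk
    have hlk : l ≤ k := Nat.right_le_pair m l
    have h₁ := h k (hK.trans hlk)
    rw [(summable_weight_mul (hbd k)).tsum_eq_add_tsum_ite m, probe_unitSeq_pair hm] at h₁
    have h₂ : |∑' n, if n = m then 0 else (1 / 8 : ℝ) ^ n * (ζ n * probe n (unitSeq k))| ≤
        4 * C * (1 / 4) ^ k * 2 := by
      refine tsum_of_norm_bounded
        (f := fun n => if n = m then 0 else (1 / 8 : ℝ) ^ n * (ζ n * probe n (unitSeq k)))
        (hasSum_geometric_two.mul_left _) fun n => ?_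
      by_cases hnm : n = m
      · rw [if_pos hnm, norm_zero]
        positivity
      rw [if_neg hnm]
      rcases lt_or_ge n k with hn | hn
      · rw [probe_unitSeq_of_lt hn (by rw [hk, Nat.unpair_pair]; exact Ne.symm hnm), mul_zero,
          mul_zero, norm_zero]
        positivity
      · rw [norm_mul, norm_pow, Real.norm_of_nonneg (by norm_num)]
        calc (1 / 8 : ℝ) ^ n * ‖ζ n * probe n (unitSeq k)‖
            ≤ (1 / 8 : ℝ) ^ n * (C * 4) := mul_le_mul_of_nonneg_left (hbd k n) (by positivity)
          _ = 4 * C * (1 / 4) ^ n * (1 / 2) ^ n := by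
              rw [show (1 / 8 : ℝ) = 1 / 4 * (1 / 2) by norm_num, mul_pow]; ring
          _ ≤ 4 * C * (1 / 4) ^ k * (1 / 2) ^ n := by
              have := pow_le_pow_of_le_one (by norm_num : (0 : ℝ) ≤ 1 / 4) (by norm_num) hn
              gcongr
    rw [← neg_eq_of_add_eq_zero_right h₁, abs_neg, ← mul_assoc, abs_mul,
      abs_of_pos (by positivity : (0 : ℝ) < (1 / 2) ^ k)] at h₂
    have h₃ : (1 / 4 : ℝ) ^ k = (1 / 2) ^ k * (1 / 2) ^ k := by rw [← mul_pow]; norm_num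
    have h₄ : |(1 / 8) ^ m * ζ m| ≤ 8 * C * (1 / 2) ^ k := by
      refine le_of_mul_le_mul_right (h₂.trans (le_of_eq ?_))
        (by positivity : (0 : ℝ) < (1 / 2) ^ k)
      rw [h₃]; ring
    refine h₄.trans ?_
    have := pow_le_pow_of_le_one (by norm_num : (0 : ℝ) ≤ 1 / 2) (by norm_num) hlk
    gcongr
  have hlim : Tendsto (fun l : ℕ => 8 * C * (1 / 2 : ℝ) ^ l) atTop (𝓝 0) := by
    simpa using (tendsto_pow_atTop_nhds_zero_of_lt_one (by norm_num : (0 : ℝ) ≤ 1 / 2)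
      (by norm_num)).const_mul (8 * C)
  have h₀ : |(1 / 8) ^ m * ζ m| ≤ 0 := ge_of_tendsto hlim <| by
    filter_upwards [eventually_ge_atTop K, eventually_gt_atTop m] with l h₁ h₂ using main l h₁ h₂
  exact (mul_eq_zero.1 (abs_nonpos_iff.1 h₀)).resolve_left (by positivity)

lemma det_eq_zero_of_cubic_eq_cube {α β γ a a' b b' c c' : ℝ} (hα : α ≠ 0) (hβ : β ≠ 0)
    (h₀ : α * a ^ 3 + β * b ^ 3 = γ * c ^ 3)
    (h₁ : α * (a ^ 2 * a') + β * (b ^ 2 * b') = γ * (c ^ 2 * c'))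
    (h₂ : α * (a * a' ^ 2) + β * (b * b' ^ 2) = γ * (c * c' ^ 2))
    (h₃ : α * a' ^ 3 + β * b' ^ 3 = γ * c' ^ 3) : a * b' = a' * b := by
  have hαβ := mul_ne_zero hα hβ
  by_contra hne
  have hD : (a * b' - a' * b) ^ 2 ≠ 0 := pow_ne_zero 2 (sub_ne_zero.2 hne)
  have e₁ : a * b = 0 := by
    refine (mul_eq_zero.1 (?_ : α * β * (a * b' - a' * b) ^ 2 * (a * b) = 0)).resolve_left
      (mul_ne_zero hαβ hD)
    linear_combination (α * (a * a' ^ 2) + β * (b * b' ^ 2)) * h₀ + γ * c ^ 3 * h₂ -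
      (α * (a ^ 2 * a') + β * (b ^ 2 * b') + γ * (c ^ 2 * c')) * h₁
  have e₂ : a' * b' = 0 := by
    refine (mul_eq_zero.1 (?_ : α * β * (a * b' - a' * b) ^ 2 * (a' * b') = 0)).resolve_left
      (mul_ne_zero hαβ hD)
    linear_combination (α * (a ^ 2 * a') + β * (b ^ 2 * b')) * h₃ + γ * c' ^ 3 * h₁ -
      (α * (a * a' ^ 2) + β * (b * b' ^ 2) + γ * (c * c' ^ 2)) * h₂
  have e₃ : a * b' + a' * b = 0 := by
    refine (mul_eq_zero.1 (?_ : α * β * (a * b' - a' * b) ^ 2 * (a * b' + a' * b) = 0)).resolve_left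
      (mul_ne_zero hαβ hD)
    linear_combination (α * a' ^ 3 + β * b' ^ 3) * h₀ + γ * c ^ 3 * h₃ -
      (α * (a * a' ^ 2) + β * (b * b' ^ 2)) * h₁ - γ * (c ^ 2 * c') * h₂
  apply hD
  linear_combination (a * b' + a' * b) * e₃ - 4 * a' * b' * e₁

lemma cross_eq_of_probe_cubic {x y z : ℕ →ᵇ ℝ} {α β γ : ℝ} (hα : α ≠ 0) (hβ : β ≠ 0)
    (h : ∀ n, α * probe n x ^ 3 + β * probe n y ^ 3 - γ * probe n z ^ 3 = 0) (i j : ℕ) :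
    x i * y j = x j * y i := by
  have key (q : ℕ) : α * (x i + 1 / ((q : ℝ) + 1) * x j) ^ 3 +
      β * (y i + 1 / ((q : ℝ) + 1) * y j) ^ 3 -
        γ * (z i + 1 / ((q : ℝ) + 1) * z j) ^ 3 = 0 := by
    have h₁ := ((((tendsto_probe_pair i j q x).pow 3).const_mul α).add
      (((tendsto_probe_pair i j q y).pow 3).const_mul β)).sub
      (((tendsto_probe_pair i j q z).pow 3).const_mul γ)
    simp only [h] at h₁
    exact tendsto_nhds_unique h₁ tendsto_const_nhds
  have k₀ := key 0
  have k₁ := key 1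
  have k₂ := key 2
  have k₃ := key 3
  norm_num at k₀ k₁ k₂ k₃
  apply det_eq_zero_of_cubic_eq_cube hα hβ (c := z i) (c' := z j) (γ := γ)
  · linear_combination (-1/6) * k₀ + (4) * k₁ + (-27/2) * k₂ + (32/3) * k₃
  · linear_combination (1/2) * k₀ + (-32/3) * k₁ + (63/2) * k₂ + (-64/3) * k₃
  · linear_combination (-13/9) * k₀ + (76/3) * k₁ + (-63) * k₂ + (352/9) * k₃
  · linear_combination (4) * k₀ + (-48) * k₁ + (108) * k₂ + (-64) * k₃

/-- The fourth power of a weighted `ℓ⁴` norm of the sequence of values `probe n s`. -/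
noncomputable def quart (s : ℕ →ᵇ ℝ) : ℝ := ∑' n, (1 / 8 : ℝ) ^ n * probe n s ^ 4

/-- A quarter of the derivative of `quart` at `x` in the direction `z`. -/
noncomputable def quartSlope (x z : ℕ →ᵇ ℝ) : ℝ :=
  ∑' n, (1 / 8 : ℝ) ^ n * (probe n x ^ 3 * probe n z)

lemma abs_probe_pow_le (n m : ℕ) (s : ℕ →ᵇ ℝ) : |probe n s ^ m| ≤ (4 * ‖s‖) ^ m := by
  rw [abs_pow]
  exact pow_le_pow_left₀ (abs_nonneg _) (abs_probe_le n s) m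

lemma summable_quart (s : ℕ →ᵇ ℝ) : Summable fun n => (1 / 8 : ℝ) ^ n * probe n s ^ 4 :=
  summable_weight_mul fun n => abs_probe_pow_le n 4 s

lemma abs_probe_pow_mul_probe_le (n : ℕ) (x z : ℕ →ᵇ ℝ) :
    |probe n x ^ 3 * probe n z| ≤ (4 * ‖x‖) ^ 3 * (4 * ‖z‖) := by
  rw [abs_mul]
  exact mul_le_mul (abs_probe_pow_le n 3 x) (abs_probe_le n z) (abs_nonneg _) (by positivity)

lemma summable_quartSlope (x z : ℕ →ᵇ ℝ) :
    Summable fun n => (1 / 8 : ℝ) ^ n * (probe n x ^ 3 * probe n z) :=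
  summable_weight_mul fun n => abs_probe_pow_mul_probe_le n x z

lemma quart_nonneg (s : ℕ →ᵇ ℝ) : 0 ≤ quart s := tsum_nonneg fun n => by positivity

lemma quart_smul (c : ℝ) (s : ℕ →ᵇ ℝ) : quart (c • s) = c ^ 4 * quart s := by
  rw [quart, quart, ← tsum_mul_left]
  exact tsum_congr fun n => by rw [map_smul, smul_eq_mul]; ring

lemma quartSlope_self (x : ℕ →ᵇ ℝ) : quartSlope x x = quart x :=
  tsum_congr fun n => by ring

lemma quartSlope_add (x z w : ℕ →ᵇ ℝ) :
    quartSlope x (z + w) = quartSlope x z + quartSlope x w := by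
  rw [quartSlope, quartSlope, quartSlope,
    ← (summable_quartSlope x z).tsum_add (summable_quartSlope x w)]
  exact tsum_congr fun n => by rw [map_add]; ring

lemma quartSlope_smul (x : ℕ →ᵇ ℝ) (c : ℝ) (z : ℕ →ᵇ ℝ) :
    quartSlope x (c • z) = c * quartSlope x z := by
  rw [quartSlope, quartSlope, ← tsum_mul_left]
  exact tsum_congr fun n => by rw [map_smul, smul_eq_mul]; ring

lemma quart_le_norm (s : ℕ →ᵇ ℝ) : quart s ≤ 300 * ‖s‖ ^ 4 := by
  have h : quart s ≤ (4 * ‖s‖) ^ 4 * (1 - 1 / 8 : ℝ)⁻¹ :=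
    (le_abs_self _).trans <| tsum_of_norm_bounded (f := fun n => (1 / 8 : ℝ) ^ n * probe n s ^ 4)
      ((hasSum_geometric_of_lt_one (by norm_num : (0 : ℝ) ≤ 1 / 8) (by norm_num)).mul_left _)
      fun n => by
        rw [norm_mul, norm_pow, Real.norm_of_nonneg (by norm_num), mul_comm]
        exact mul_le_mul_of_nonneg_right (abs_probe_pow_le n 4 s) (by positivity)
  refine h.trans ?_
  have : 0 ≤ ‖s‖ ^ 4 := by positivity
  norm_num [mul_pow]
  linarith

lemma exists_quart_add_smul_le (x z : ℕ →ᵇ ℝ) :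
    ∃ C, ∀ t ∈ Set.Ioc (0 : ℝ) 1,
      quart (x + t • z) ≤ quart x + t * (4 * quartSlope x z) + t ^ 2 * C := by
  set B := 4 * ‖x‖ + 4 * ‖z‖ with hB
  refine ⟨∑' n : ℕ, (1 / 8 : ℝ) ^ n * (11 * B ^ 4), fun t ht => ?_⟩
  have hs : Summable fun n : ℕ => (1 / 8 : ℝ) ^ n * (11 * B ^ 4) := summable_weight.mul_right _
  have h := (((summable_quart x).hasSum.add
    ((summable_quartSlope x z).hasSum.mul_left (t * 4))).add (hs.hasSum.mul_left (t ^ 2)))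
  rw [← mul_assoc t 4]
  refine hasSum_le (fun n => ?_) (summable_quart _).hasSum h
  have hx : |probe n x| ≤ B := (abs_probe_le n x).trans (by have := norm_nonneg z; linarith)
  have hz : |probe n z| ≤ B := (abs_probe_le n z).trans (by have := norm_nonneg x; linarith)
  have hB₀ : 0 ≤ B := by positivity
  rw [map_add, map_smul, smul_eq_mul]
  generalize probe n x = a at *
  generalize probe n z = b at *
  have ha₂ : a ^ 2 ≤ B ^ 2 := sq_le_sq' (by linarith [abs_le.1 hx]) (abs_le.1 hx).2
  have hb₂ : b ^ 2 ≤ B ^ 2 := sq_le_sq' (by linarith [abs_le.1 hz]) (abs_le.1 hz).2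
  have h₁ : a ^ 2 * b ^ 2 ≤ B ^ 4 := by
    calc a ^ 2 * b ^ 2 ≤ B ^ 2 * B ^ 2 := by gcongr
      _ = B ^ 4 := by ring
  have h₂ : t * (a * b ^ 3) ≤ B ^ 4 := by
    refine (le_abs_self _).trans ?_
    rw [abs_mul, abs_of_pos ht.1, abs_mul, abs_pow]
    calc t * (|a| * |b| ^ 3) ≤ 1 * (B * B ^ 3) := by
          have := ht.2
          have := ht.1
          gcongr
      _ = B ^ 4 := by ring
  have h₃ : t ^ 2 * b ^ 4 ≤ B ^ 4 := by
    calc t ^ 2 * b ^ 4 ≤ 1 * (B ^ 2 * B ^ 2) := by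
          rw [show b ^ 4 = b ^ 2 * b ^ 2 by ring]
          have := pow_le_one₀ ht.1.le ht.2 (n := 2)
          gcongr
      _ = B ^ 4 := by ring
  have h₄ : (a + t * b) ^ 4 = a ^ 4 + t * 4 * (a ^ 3 * b) +
      t ^ 2 * (6 * (a ^ 2 * b ^ 2) + 4 * (t * (a * b ^ 3)) + t ^ 2 * b ^ 4) := by ring
  have h₅ : (a + t * b) ^ 4 ≤ a ^ 4 + t * 4 * (a ^ 3 * b) + t ^ 2 * (11 * B ^ 4) := by
    rw [h₄]
    gcongr
    linarith
  calc (1 / 8 : ℝ) ^ n * (a + t * b) ^ 4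
      ≤ (1 / 8 : ℝ) ^ n * (a ^ 4 + t * 4 * (a ^ 3 * b) + t ^ 2 * (11 * B ^ 4)) := by gcongr
    _ = _ := by ring

lemma tendsto_quart_trunc (s : ℕ →ᵇ ℝ) :
    Tendsto (fun M => quart (trunc M s)) atTop (𝓝 (quart s)) := by
  refine tendsto_tsum_of_dominated_convergence
    (bound := fun n => (1 / 8 : ℝ) ^ n * (4 * ‖s‖) ^ 4) (summable_weight.mul_right _)
    (fun n => ((tendsto_probe_trunc n s).pow 4).const_mul _) (.of_forall fun M n => ?_)
  rw [norm_mul, norm_pow, Real.norm_of_nonneg (by norm_num)]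
  refine mul_le_mul_of_nonneg_left ((abs_probe_pow_le n 4 _).trans ?_) (by positivity)
  have := norm_trunc_le M s
  gcongr

lemma quart_combo_le (x y : ℕ →ᵇ ℝ) {a b : ℝ} (ha : 0 ≤ a) (hb : 0 ≤ b) (hab : a + b = 1) :
    quart (a • x + b • y) ≤ a * quart x + b * quart y := by
  refine hasSum_le (fun n => ?_) (summable_quart _).hasSum
    (((summable_quart x).hasSum.mul_left a).add ((summable_quart y).hasSum.mul_left b))
  have h := (Even.convexOn_pow (𝕜 := ℝ) (n := 4) (by decide)).2 (Set.mem_univ (probe n x))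
    (Set.mem_univ (probe n y)) ha hb hab
  simp only [smul_eq_mul] at h
  rw [map_add, map_smul, map_smul, smul_eq_mul, smul_eq_mul]
  refine (mul_le_mul_of_nonneg_left h (by positivity)).trans (le_of_eq (by ring))

lemma quart_midpoint_lt {x y : ℕ →ᵇ ℝ} (hxy : x ≠ y) :
    quart ((1 / 2 : ℝ) • x + (1 / 2 : ℝ) • y) < 1 / 2 * quart x + 1 / 2 * quart y := by
  obtain ⟨m, hm⟩ : ∃ m, probe m x ≠ probe m y := by
    by_contra! h
    exact hxy (sub_eq_zero.1 (eq_zero_of_probe_eq_zero fun n => by rw [map_sub, h, sub_self]))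
  refine hasSum_lt (i := m) (fun n => ?_) ?_ (summable_quart _).hasSum
    (((summable_quart x).hasSum.mul_left (1 / 2)).add
      ((summable_quart y).hasSum.mul_left (1 / 2)))
  · have h := (Even.convexOn_pow (𝕜 := ℝ) (n := 4) (by decide)).2 (Set.mem_univ (probe n x))
      (Set.mem_univ (probe n y)) (by norm_num : (0 : ℝ) ≤ 1 / 2)
      (by norm_num : (0 : ℝ) ≤ 1 / 2) (by norm_num)
    simp only [smul_eq_mul] at h
    rw [map_add, map_smul, map_smul, smul_eq_mul, smul_eq_mul]
    refine (mul_le_mul_of_nonneg_left h (by positivity)).trans (le_of_eq (by ring))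
  · have h := (Even.strictConvexOn_pow (n := 4) (by decide) (by decide)).2
      (Set.mem_univ (probe m x))
      (Set.mem_univ (probe m y)) hm (by norm_num : (0 : ℝ) < 1 / 2)
      (by norm_num : (0 : ℝ) < 1 / 2) (by norm_num)
    simp only [smul_eq_mul] at h
    rw [map_add, map_smul, map_smul, smul_eq_mul, smul_eq_mul]
    refine (mul_lt_mul_of_pos_left h (by positivity)).trans_le (le_of_eq (by ring))

/-- The fourth power of the norm `mixed`. -/
noncomputable def energy (s : ℕ →ᵇ ℝ) : ℝ := lux s ^ 4 + quart s

lemma energy_nonneg (s : ℕ →ᵇ ℝ) : 0 ≤ energy s := by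
  have := quart_nonneg s
  unfold energy
  positivity

lemma energy_smul (c : ℝ) (s : ℕ →ᵇ ℝ) : energy (c • s) = c ^ 4 * energy s := by
  rw [energy, energy, quart_smul, map_smul_eq_mul, mul_pow, Real.norm_eq_abs,
    Even.pow_abs (by decide)]
  ring

lemma lux_pow_combo_le (x y : ℕ →ᵇ ℝ) {a b : ℝ} (ha : 0 ≤ a) (hb : 0 ≤ b) (hab : a + b = 1) :
    lux (a • x + b • y) ^ 4 ≤ a * lux x ^ 4 + b * lux y ^ 4 :=
  (lux.convexOn.pow (fun s _ => apply_nonneg lux s) 4).2 trivial trivial ha hb hab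

lemma energy_combo_le (x y : ℕ →ᵇ ℝ) {a b : ℝ} (ha : 0 ≤ a) (hb : 0 ≤ b) (hab : a + b = 1) :
    energy (a • x + b • y) ≤ a * energy x + b * energy y := by
  have h₁ := lux_pow_combo_le x y ha hb hab
  have h₂ := quart_combo_le x y ha hb hab
  unfold energy
  linarith

lemma fourthRoot_pow {u : ℝ} (hu : 0 ≤ u) : √√u ^ 4 = u := by
  rw [show √√u ^ 4 = (√√u ^ 2) ^ 2 by ring, Real.sq_sqrt (Real.sqrt_nonneg _), Real.sq_sqrt hu]

/-- The norm on `ℓ^∞` combining `lux` and the weighted `ℓ⁴` norm of the values of `probe`. -/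
noncomputable def mixed : Seminorm ℝ (ℕ →ᵇ ℝ) :=
  Seminorm.of (fun s => √√(energy s))
    (fun x y => by
      have key (s : ℕ →ᵇ ℝ) {c : ℝ} (hc : √√(energy s) < c) : energy (c⁻¹ • s) ≤ 1 := by
        have hc₀ : 0 < c := (Real.sqrt_nonneg _).trans_lt hc
        have h := pow_le_pow_left₀ (Real.sqrt_nonneg _) hc.le 4
        rw [fourthRoot_pow (energy_nonneg s)] at h
        rw [energy_smul, inv_pow, inv_mul_le_one₀ (by positivity)]
        exact h
      refine le_of_forall_pos_le_add fun ε hε => ?_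
      set a := √√(energy x) + ε / 2 with ha
      set b := √√(energy y) + ε / 2 with hb
      have ha₀ : 0 < a := by positivity
      have hb₀ : 0 < b := by positivity
      have h₁ := key x (c := a) (by linarith)
      have h₂ := key y (c := b) (by linarith)
      have h₃ := energy_combo_le (a⁻¹ • x) (b⁻¹ • y) (by positivity : 0 ≤ a / (a + b))
        (by positivity : 0 ≤ b / (a + b)) (by field_simp)
      have h₄ : (a / (a + b)) • a⁻¹ • x + (b / (a + b)) • b⁻¹ • y = (a + b)⁻¹ • (x + y) := by
        rw [smul_smul, smul_smul, smul_add]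
        congr 2 <;> field_simp
      have h₅ : a / (a + b) + b / (a + b) = 1 := by field_simp
      have h₆ : energy ((a + b)⁻¹ • (x + y)) ≤ 1 := by
        rw [← h₄]
        refine h₃.trans ?_
        have : 0 ≤ a / (a + b) := by positivity
        have : 0 ≤ b / (a + b) := by positivity
        nlinarith
      rw [energy_smul, inv_pow, inv_mul_le_one₀ (by positivity)] at h₆
      have h₇ : √√(energy (x + y)) ≤ a + b := by
        refine le_of_pow_le_pow_left₀ (n := 4) (by norm_num) (by positivity) ?_
        rwa [fourthRoot_pow (energy_nonneg _)]
      linarith)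
    fun c s => by
      refine (pow_left_inj₀ (Real.sqrt_nonneg _) (by positivity) (four_ne_zero)).1 ?_
      rw [mul_pow, fourthRoot_pow (energy_nonneg _), fourthRoot_pow (energy_nonneg _),
        energy_smul, Real.norm_eq_abs, Even.pow_abs (by decide)]

lemma mixed_pow (s : ℕ →ᵇ ℝ) : mixed s ^ 4 = energy s := fourthRoot_pow (energy_nonneg s)

lemma mixed_le_iff {s : ℕ →ᵇ ℝ} {c : ℝ} (hc : 0 ≤ c) : mixed s ≤ c ↔ energy s ≤ c ^ 4 := by
  rw [← mixed_pow, pow_le_pow_iff_left₀ (apply_nonneg _ _) hc (by norm_num)]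

lemma lux_le_mixed (s : ℕ →ᵇ ℝ) : lux s ≤ mixed s := by
  rw [← pow_le_pow_iff_left₀ (apply_nonneg _ _) (apply_nonneg _ _) (n := 4) (by norm_num),
    mixed_pow]
  exact le_add_of_nonneg_right (quart_nonneg s)

lemma norm_le_mixed (s : ℕ →ᵇ ℝ) : ‖s‖ ≤ 2 * mixed s := by
  linarith [norm_le_lux s, lux_le_mixed s]

lemma mixed_le_norm (s : ℕ →ᵇ ℝ) : mixed s ≤ 5 * ‖s‖ := by
  rw [mixed_le_iff (by positivity), energy]
  have h₁ := pow_le_pow_left₀ (apply_nonneg _ _) (lux_le_norm s) 4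
  have h₂ := quart_le_norm s
  have h₃ : 0 ≤ ‖s‖ ^ 4 := by positivity
  rw [mul_pow]
  linarith

lemma mixed_add_lt_two {x y : ℕ →ᵇ ℝ} (hx : mixed x ≤ 1) (hy : mixed y ≤ 1) (hxy : x ≠ y) :
    mixed (x + y) < 2 := by
  rw [mixed_le_iff zero_le_one, one_pow] at hx hy
  have h₁ := quart_midpoint_lt hxy
  have h₂ := lux_pow_combo_le x y (by norm_num : (0 : ℝ) ≤ 1 / 2) (by norm_num : (0 : ℝ) ≤ 1 / 2)
    (by norm_num)
  have h₃ : energy ((1 / 2 : ℝ) • x + (1 / 2 : ℝ) • y) < 1 := by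
    unfold energy at *
    linarith
  rw [← smul_add, energy_smul, ← mixed_pow] at h₃
  refine lt_of_pow_lt_pow_left₀ 4 (by norm_num) ?_
  linarith

/-- The null sequences. -/
def nullSeq : Submodule ℝ (ℕ →ᵇ ℝ) where
  carrier := {s | Tendsto s atTop (𝓝 0)}
  add_mem' {s t} hs ht := by
    have := Tendsto.add hs ht
    rwa [add_zero] at this
  zero_mem' := tendsto_const_nhds
  smul_mem' c s hs := by
    have := Tendsto.const_mul c hs
    rwa [mul_zero] at this

lemma isClosed_nullSeq : IsClosed (nullSeq : Set (ℕ →ᵇ ℝ)) := by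
  refine isClosed_of_closure_subset fun s hs => Metric.tendsto_atTop.2 fun ε hε => ?_
  obtain ⟨t, ht, hst⟩ := Metric.mem_closure_iff.1 hs (ε / 2) (by positivity)
  obtain ⟨N, hN⟩ := Metric.tendsto_atTop.1 ht (ε / 2) (by positivity)
  refine ⟨N, fun n hn => (dist_triangle _ (t n) _).trans_lt ?_⟩
  have := BoundedContinuousFunction.dist_coe_le_dist (f := s) (g := t) n
  linarith [hN n hn]

lemma unitSeq_mem_nullSeq (k : ℕ) : unitSeq k ∈ nullSeq :=
  tendsto_const_nhds.congr' <| (eventually_gt_atTop k).mono fun n hn => by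
    rw [unitSeq_apply, if_neg hn.ne']

/-- The space of null sequences with the norm `mixed`. -/
def NullSpace : Type := nullSeq

namespace NullSpace

noncomputable instance : NormedAddCommGroup NullSpace :=
  AddGroupNorm.toNormedAddCommGroup (E := nullSeq)
    { toFun x := mixed x.1
      map_zero' := map_zero mixed
      add_le' x y := map_add_le_add mixed x.1 y.1
      neg' x := map_neg_eq_map mixed x.1
      eq_zero_of_map_eq_zero' x hx := by
        refine Subtype.ext ?_
        rw [ZeroMemClass.coe_zero, ← norm_le_zero_iff]
        have h := norm_le_mixed x.1
        rw [hx] at h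
        linarith }

noncomputable instance : NormedSpace ℝ NullSpace :=
  letI : Module ℝ NullSpace := nullSeq.module
  { norm_smul_le c x := (map_smul_eq_mul mixed c x.1).le }

/-- The inclusion of `NullSpace` into the space of bounded sequences. -/
noncomputable def seqₗ : NullSpace →ₗ[ℝ] (ℕ →ᵇ ℝ) := nullSeq.subtype

lemma seqₗ_injective : Function.Injective seqₗ := nullSeq.subtype_injective

lemma norm_eq_mixed (x : NullSpace) : ‖x‖ = mixed (seqₗ x) := rfl

/-- The underlying bounded sequence of an element of `NullSpace`. -/
noncomputable def seq : NullSpace →L[ℝ] (ℕ →ᵇ ℝ) := seqₗ.mkContinuous 2 fun _ => norm_le_mixed _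

lemma seq_injective : Function.Injective seq := seqₗ_injective

lemma tendsto_seq (x : NullSpace) : Tendsto (seq x) atTop (𝓝 0) := x.2

lemma exists_seq_eq {s : ℕ →ᵇ ℝ} (hs : s ∈ nullSeq) : ∃ x : NullSpace, seq x = s := ⟨⟨s, hs⟩, rfl⟩

lemma norm_pow_eq (x : NullSpace) : ‖x‖ ^ 4 = energy (seq x) := mixed_pow _

lemma norm_seq_le (x : NullSpace) : ‖seq x‖ ≤ 2 * ‖x‖ := norm_le_mixed _

lemma norm_le_norm_seq (x : NullSpace) : ‖x‖ ≤ 5 * ‖seq x‖ := mixed_le_norm _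

lemma tendsto_of_tendsto_seq {u : ℕ → NullSpace} {x : NullSpace}
    (h : Tendsto (fun n => seq (u n)) atTop (𝓝 (seq x))) : Tendsto u atTop (𝓝 x) := by
  rw [tendsto_iff_norm_sub_tendsto_zero] at h ⊢
  refine squeeze_zero (fun _ => norm_nonneg _) (fun n => norm_le_norm_seq _) ?_
  simpa using h.const_mul 5

instance : CompleteSpace NullSpace := by
  refine Metric.complete_of_cauchySeq_tendsto fun u hu => ?_
  obtain ⟨s, hs⟩ := cauchySeq_tendsto_of_complete (seq.uniformContinuous.comp_cauchySeq hu)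
  obtain ⟨x, rfl⟩ := exists_seq_eq
    (isClosed_nullSeq.mem_of_tendsto hs (.of_forall fun n => tendsto_seq (u n)))
  exact ⟨x, tendsto_of_tendsto_seq hs⟩

/-- The standard unit vectors. -/
noncomputable def unit (k : ℕ) : NullSpace := ⟨unitSeq k, unitSeq_mem_nullSeq k⟩

@[simp] lemma seq_unit (k : ℕ) : seq (unit k) = unitSeq k := rfl

lemma linearIndependent_unit : LinearIndependent ℝ unit := by
  rw [linearIndependent_iff']
  intro S c h k hk
  have h₁ := congrArg (fun x => seq x k) h
  simpa [map_sum, hk] using h₁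

lemma not_finiteDimensional : ¬ FiniteDimensional ℝ NullSpace := fun _ =>
  not_finite_iff_infinite.2 inferInstance (linearIndependent_unit.finite)

/-- The truncation of a bounded sequence, as an element of `NullSpace`. -/
noncomputable def cut (M : ℕ) (s : ℕ →ᵇ ℝ) : NullSpace := ∑ k ∈ Finset.range M, s k • unit k

@[simp] lemma seq_cut (M : ℕ) (s : ℕ →ᵇ ℝ) : seq (cut M s) = trunc M s := by
  simp [cut, trunc]

lemma tendsto_cut (x : NullSpace) : Tendsto (fun M => cut M (seq x)) atTop (𝓝 x) := by
  refine tendsto_of_tendsto_seq (Metric.tendsto_atTop.2 fun ε hε => ?_)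
  obtain ⟨N, hN⟩ := Metric.tendsto_atTop.1 (tendsto_seq x) (ε / 2) (by positivity)
  refine ⟨N, fun M hM => lt_of_le_of_lt ?_ (half_lt_self hε)⟩
  refine (BoundedContinuousFunction.dist_le (by positivity)).2 fun k => ?_
  rw [seq_cut, trunc_apply]
  split_ifs with hk
  · rw [dist_self]; positivity
  · rw [dist_comm]
    exact (hN k (by omega)).le

/-- The coordinate functionals. -/
noncomputable def coord (k : ℕ) : NullSpace →L[ℝ] ℝ :=
  (BoundedContinuousFunction.evalCLM ℝ k).comp seq

@[simp] lemma coord_apply (k : ℕ) (x : NullSpace) : coord k x = seq x k := rfl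

lemma norm_coord_le (k : ℕ) : ‖coord k‖ ≤ 2 :=
  (coord k).opNorm_le_bound zero_le_two fun x =>
    ((seq x).norm_coe_le_norm k).trans (norm_seq_le x)

lemma summable_abs_apply_unit (f : NullSpace →L[ℝ] ℝ) : Summable fun k => |f (unit k)| := by
  refine summable_of_sum_range_le (c := ‖f‖ * 5) (fun _ => abs_nonneg _) fun N => ?_
  let σ : ℕ →ᵇ ℝ := BoundedContinuousFunction.ofNormedAddCommGroupDiscrete
    (fun k => (SignType.sign (f (unit k)) : ℝ)) 1 fun k => by
      rcases SignType.sign (f (unit k)) with _ | _ | _ <;> simp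
  have hσ : ‖σ‖ ≤ 1 := BoundedContinuousFunction.norm_ofNormedAddCommGroup_le _ zero_le_one _
  have h₁ : f (cut N σ) = ∑ k ∈ Finset.range N, |f (unit k)| := by
    rw [cut, map_sum]
    exact Finset.sum_congr rfl fun k _ => by
      rw [map_smul, smul_eq_mul]; exact sign_mul_self _
  rw [← h₁]
  refine (le_abs_self _).trans ((f.le_opNorm _).trans ?_)
  refine mul_le_mul_of_nonneg_left ((norm_le_norm_seq _).trans ?_) (norm_nonneg f)
  rw [seq_cut]
  linarith [norm_trunc_le N σ]

/-- The coordinate functionals span a dense subspace of the dual. -/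
lemma tendsto_sum_coord (f : NullSpace →L[ℝ] ℝ) :
    Tendsto (fun M => ∑ k ∈ Finset.range M, f (unit k) • coord k) atTop (𝓝 f) := by
  rw [tendsto_iff_norm_sub_tendsto_zero]
  have hlim := (tendsto_sum_nat_add fun k => |f (unit k)|).mul_const 2
  rw [zero_mul] at hlim
  refine squeeze_zero (fun _ => norm_nonneg _) (fun M => ?_) hlim
  refine ContinuousLinearMap.opNorm_le_bound _
    (mul_nonneg (tsum_nonneg fun _ => abs_nonneg _) zero_le_two) fun x => ?_
  have hbd (k : ℕ) : ‖f (unit k) * seq x k‖ ≤ |f (unit k)| * ‖seq x‖ := by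
    rw [norm_mul]
    exact mul_le_mul_of_nonneg_left ((seq x).norm_coe_le_norm k) (norm_nonneg _)
  have hs : Summable fun k => f (unit k) * seq x k :=
    .of_norm_bounded ((summable_abs_apply_unit f).mul_right _) hbd
  have h₁ : f x = ∑' k, f (unit k) * seq x k := by
    refine tendsto_nhds_unique ((f.continuous.tendsto x).comp (tendsto_cut x)) ?_
    refine hs.hasSum.tendsto_sum_nat.congr fun M => ?_
    simp [cut, mul_comm]
  have h₂ : (∑ k ∈ Finset.range M, f (unit k) • coord k - f) x =
      -∑' k, f (unit (k + M)) * seq x (k + M) := by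
    have h := hs.sum_add_tsum_nat_add M
    rw [sub_apply, sum_apply, h₁, ← h]
    simp
  rw [h₂, norm_neg]
  have hs' := (summable_nat_add_iff M).2 (summable_abs_apply_unit f)
  refine (tsum_of_norm_bounded (hs'.hasSum.mul_right ‖seq x‖) fun k => hbd (k + M)).trans ?_
  rw [mul_assoc]
  exact mul_le_mul_of_nonneg_left (norm_seq_le x) (tsum_nonneg fun _ => abs_nonneg _)

end NullSpace

/-- **Helly's theorem** on finite systems of linear equations, in approximate form. -/
lemma exists_norm_le_forall_abs_sub_lt {X : Type*} [NormedAddCommGroup X] [NormedSpace ℝ X]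
    (F : (X →L[ℝ] ℝ) →L[ℝ] ℝ) {ι : Type*} [Fintype ι] (g : ι → X →L[ℝ] ℝ) {ε : ℝ} (hε : 0 < ε) :
    ∃ x : X, ‖x‖ ≤ ‖F‖ ∧ ∀ i, |g i x - F (g i)| < ε := by
  classical
  let T : X →L[ℝ] (ι → ℝ) := ContinuousLinearMap.pi g
  set S : Set (ι → ℝ) := closure (T '' Metric.closedBall 0 ‖F‖) with hS
  have hmem : (fun i => F (g i)) ∈ S := by
    by_contra hcon
    obtain ⟨ℓ, u, hℓ, hu⟩ := geometric_hahn_banach_closed_point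
      ((convex_closedBall (0 : X) ‖F‖).linear_image T.toLinearMap).closure isClosed_closure hcon
    have hball (x : X) (hx : ‖x‖ ≤ ‖F‖) : ℓ (T x) < u :=
      hℓ _ (subset_closure ⟨x, mem_closedBall_zero_iff.2 hx, rfl⟩)
    have hu₀ : 0 < u := by simpa using hball 0 (by rw [norm_zero]; exact norm_nonneg F)
    have hF : F (ℓ.comp T) = ℓ fun i => F (g i) := by
      have h₁ : ℓ.comp T = ∑ i, ℓ (Pi.single i 1) • g i := by
        ext x
        rw [ContinuousLinearMap.comp_apply, pi_eq_sum_univ' (T x), map_sum]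
        simp [T, mul_comm]
      rw [h₁, pi_eq_sum_univ' fun i => F (g i), map_sum, map_sum]
      simp [mul_comm]
    have hle : ‖F‖ * ‖ℓ.comp T‖ ≤ u := by
      rcases (norm_nonneg F).eq_or_lt with h | h
      · rw [← h, zero_mul]; exact hu₀.le
      · rw [← le_div_iff₀' h]
        refine ContinuousLinearMap.opNorm_le_of_unit_norm (by positivity) fun z hz => ?_
        have hnorm (c : ℝ) (hc : |c| = ‖F‖) : c * ℓ (T z) < u := by
          have := hball (c • z) (by rw [norm_smul, hz, mul_one]; exact hc.le)
          simpa using this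
        rw [le_div_iff₀' h, ContinuousLinearMap.comp_apply, Real.norm_eq_abs]
        rcases abs_cases (ℓ (T z)) with ⟨h', -⟩ | ⟨h', -⟩ <;> rw [h']
        · exact (hnorm ‖F‖ (abs_of_pos h)).le
        · have := hnorm (-‖F‖) (by rw [abs_neg, abs_of_pos h])
          linarith
    have := (le_abs_self _).trans (F.le_opNorm (ℓ.comp T))
    rw [hF] at this
    linarith
  obtain ⟨_, ⟨x, hx, rfl⟩, hxε⟩ := Metric.mem_closure_iff.1 hmem ε hε
  refine ⟨x, mem_closedBall_zero_iff.1 hx, fun i => ?_⟩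
  have := (dist_pi_lt_iff hε).1 hxε i
  rwa [dist_comm] at this

namespace NullSpace

/-- The bounded sequence representing an element of the bidual. -/
noncomputable def bidualSeq (F : (NullSpace →L[ℝ] ℝ) →L[ℝ] ℝ) : ℕ →ᵇ ℝ :=
  BoundedContinuousFunction.ofNormedAddCommGroupDiscrete (fun k => F (coord k)) (‖F‖ * 2) fun k =>
    (F.le_opNorm _).trans (mul_le_mul_of_nonneg_left (norm_coord_le k) (norm_nonneg F))

@[simp] lemma bidualSeq_apply (F : (NullSpace →L[ℝ] ℝ) →L[ℝ] ℝ) (k : ℕ) :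
    bidualSeq F k = F (coord k) := rfl

lemma tendsto_apply_cut_bidualSeq (F : (NullSpace →L[ℝ] ℝ) →L[ℝ] ℝ) (f : NullSpace →L[ℝ] ℝ) :
    Tendsto (fun M => f (cut M (bidualSeq F))) atTop (𝓝 (F f)) := by
  refine ((F.continuous.tendsto f).comp (tendsto_sum_coord f)).congr fun M => ?_
  simp [cut, mul_comm]

lemma bidualSeq_injective : Function.Injective bidualSeq := by
  intro F G h
  ext f
  have h₁ := tendsto_apply_cut_bidualSeq G f
  rw [← h] at h₁
  exact tendsto_nhds_unique (tendsto_apply_cut_bidualSeq F f) h₁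

lemma norm_le_mixed_bidualSeq (F : (NullSpace →L[ℝ] ℝ) →L[ℝ] ℝ) : ‖F‖ ≤ mixed (bidualSeq F) := by
  refine F.opNorm_le_bound (apply_nonneg _ _) fun f => ?_
  rw [← pow_le_pow_iff_left₀ (norm_nonneg _)
    (mul_nonneg (apply_nonneg _ _) (norm_nonneg _)) (n := 4) (by norm_num), mul_pow, mixed_pow]
  refine le_of_tendsto_of_tendsto' ((tendsto_apply_cut_bidualSeq F f).norm.pow 4)
    (((tendsto_quart_trunc (bidualSeq F)).const_add (lux (bidualSeq F) ^ 4)).mul_const _)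
    fun M => ?_
  refine (pow_le_pow_left₀ (norm_nonneg _) (f.le_opNorm _) 4).trans ?_
  rw [mul_pow, mul_comm, norm_pow_eq, seq_cut, energy]
  have := pow_le_pow_left₀ (apply_nonneg _ _) (lux_trunc_le M (bidualSeq F)) 4
  gcongr

lemma apply_probe (F : (NullSpace →L[ℝ] ℝ) →L[ℝ] ℝ) (n : ℕ) :
    F ((probe n).comp seq) = probe n (bidualSeq F) := by
  refine tendsto_nhds_unique (tendsto_apply_cut_bidualSeq F _) ?_
  simpa using tendsto_probe_trunc n (bidualSeq F)

lemma lux_trunc_add_sum_le (F : (NullSpace →L[ℝ] ℝ) →L[ℝ] ℝ) (M N : ℕ) :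
    lux (trunc M (bidualSeq F)) ^ 4 +
      ∑ n ∈ Finset.range N, (1 / 8 : ℝ) ^ n * probe n (bidualSeq F) ^ 4 ≤ ‖F‖ ^ 4 := by
  let g : Fin M ⊕ Fin N → NullSpace →L[ℝ] ℝ :=
    Sum.elim (fun k => coord k) fun n => (probe n).comp seq
  choose x hx hxF using fun j : ℕ => exists_norm_le_forall_abs_sub_lt F g
    (Nat.one_div_pos_of_nat (n := j) (α := ℝ))
  have hlim (i : Fin M ⊕ Fin N) : Tendsto (fun j => g i (x j)) atTop (𝓝 (F (g i))) :=
    tendsto_iff_norm_sub_tendsto_zero.2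
      (squeeze_zero (fun _ => norm_nonneg _) (fun j => (hxF j i).le)
        (tendsto_one_div_add_atTop_nhds_zero_nat (𝕜 := ℝ)))
  have h₁ : Tendsto (fun j => trunc M (seq (x j))) atTop (𝓝 (trunc M (bidualSeq F))) :=
    tendsto_finsetSum _ fun k hk =>
      (hlim (Sum.inl ⟨k, Finset.mem_range.1 hk⟩)).smul_const _
  have h₂ : Tendsto (fun j => ∑ n ∈ Finset.range N, (1 / 8 : ℝ) ^ n * probe n (seq (x j)) ^ 4) atTop
      (𝓝 (∑ n ∈ Finset.range N, (1 / 8 : ℝ) ^ n * probe n (bidualSeq F) ^ 4)) :=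
    tendsto_finsetSum _ fun n hn => by
      rw [← apply_probe]
      exact ((hlim (Sum.inr ⟨n, Finset.mem_range.1 hn⟩)).pow 4).const_mul _
  refine le_of_tendsto' ((((continuous_lux.tendsto _).comp h₁).pow 4).add h₂) fun j => ?_
  refine le_trans ?_ (pow_le_pow_left₀ (norm_nonneg _) (hx j) 4)
  rw [norm_pow_eq, energy]
  exact add_le_add (pow_le_pow_left₀ (apply_nonneg _ _) (lux_trunc_le M _) 4)
    ((summable_quart _).sum_le_tsum _ fun n _ => by positivity)

lemma mixed_bidualSeq_le_norm (F : (NullSpace →L[ℝ] ℝ) →L[ℝ] ℝ) : mixed (bidualSeq F) ≤ ‖F‖ := by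
  set s := bidualSeq F
  have h₁ (M : ℕ) : lux (trunc M s) ^ 4 ≤ ‖F‖ ^ 4 - quart s := by
    have : quart s ≤ ‖F‖ ^ 4 - lux (trunc M s) ^ 4 :=
      Real.tsum_le_of_sum_range_le (fun n => by positivity) fun N => by
        linarith [lux_trunc_add_sum_le F M N]
    linarith
  have h₀ : 0 ≤ ‖F‖ ^ 4 - quart s := le_trans (by positivity) (h₁ 0)
  have h₂ : lux s ≤ √√(‖F‖ ^ 4 - quart s) := by
    refine lux_le_of_trunc (Real.sqrt_nonneg _) fun M => ?_
    refine le_of_pow_le_pow_left₀ (n := 4) (by norm_num) (Real.sqrt_nonneg _) ?_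
    rw [fourthRoot_pow h₀]
    exact h₁ M
  have h₃ := pow_le_pow_left₀ (apply_nonneg _ _) h₂ 4
  rw [fourthRoot_pow h₀] at h₃
  rw [mixed_le_iff (norm_nonneg F), energy]
  linarith

instance : StrictConvexSpace ℝ ((NullSpace →L[ℝ] ℝ) →L[ℝ] ℝ) := by
  refine StrictConvexSpace.of_norm_add_ne_two fun F G hF hG hFG => ne_of_lt ?_
  have h := mixed_add_lt_two ((mixed_bidualSeq_le_norm F).trans hF.le)
    ((mixed_bidualSeq_le_norm G).trans hG.le) (bidualSeq_injective.ne hFG)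
  refine lt_of_le_of_lt (norm_le_mixed_bidualSeq _) (lt_of_eq_of_lt (congrArg _ ?_) h)
  ext k
  rfl

lemma apply_le_quartSlope {x z : NullSpace} (hx : ‖x‖ = 1)
    (hz : ∀ᶠ t in 𝓝[>] (0 : ℝ), lux (seq x + t • seq z) ≤ lux (seq x))
    {f : NullSpace →L[ℝ] ℝ} (hf : ‖f‖ ≤ 1) (hfx : f x = 1) :
    f z ≤ quartSlope (seq x) (seq z) := by
  obtain ⟨C, hC⟩ := exists_quart_add_smul_le (seq x) (seq z)
  have hlim : Tendsto (fun t : ℝ => quartSlope (seq x) (seq z) + t * (C / 4)) (𝓝[>] 0)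
      (𝓝 (quartSlope (seq x) (seq z))) :=
    tendsto_nhdsWithin_of_tendsto_nhds <| by
      have : Continuous fun t : ℝ => quartSlope (seq x) (seq z) + t * (C / 4) := by fun_prop
      simpa using this.tendsto 0
  refine ge_of_tendsto hlim ?_
  filter_upwards [hz, Ioc_mem_nhdsGT (zero_lt_one' ℝ)] with t ht ht₁
  have hE : lux (seq x) ^ 4 + quart (seq x) = 1 := by
    have := norm_pow_eq x
    rw [hx, one_pow] at this
    exact this.symm
  have h₁ : f (x + t • z) ^ 4 ≤ ‖x + t • z‖ ^ 4 := by
    rw [← (by decide : Even 4).pow_abs]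
    exact pow_le_pow_left₀ (abs_nonneg _) (f.le_of_opNorm_le hf _ |>.trans_eq (one_mul _)) 4
  rw [norm_pow_eq, energy, map_add, map_smul, hfx, smul_eq_mul, map_add, map_smul] at h₁
  have h₂ := pow_le_pow_left₀ (apply_nonneg lux _) ht 4
  have h₃ := hC t ht₁
  have h₄ : 1 + 4 * (t * f z) ≤ (1 + t * f z) ^ 4 := by
    nlinarith [mul_nonneg (sq_nonneg (t * f z)) (sq_nonneg (t * f z + 2)), sq_nonneg (t * f z)]
  refine le_of_mul_le_mul_left ?_ (mul_pos zero_lt_four ht₁.1)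
  linarith

/-- A functional attaining its norm at `x` is determined by its value at `x`. -/
lemma apply_eq_of_abs_apply_eq_norm {x : NullSpace} (hx : ‖x‖ = 1)
    {L : (ℕ →ᵇ ℝ) →ₗ[ℝ] ℝ} (hLx : L (seq x) = 1)
    (hL : ∀ z : ℕ →ᵇ ℝ, Tendsto z atTop (𝓝 0) → L z < 0 →
      ∀ᶠ t in 𝓝[>] (0 : ℝ), lux (seq x + t • z) ≤ lux (seq x))
    {f : NullSpace →L[ℝ] ℝ} (hf : |f x| = ‖f‖) (z : NullSpace) :
    f z = f x * (quartSlope (seq x) (seq z) + lux (seq x) ^ 4 * L (seq z)) := by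
  rcases eq_or_ne (f x) 0 with h₀ | h₀
  · rw [h₀, abs_zero] at hf
    rw [norm_eq_zero.1 hf.symm]
    simp
  set g := (f x)⁻¹ • f with hg
  have hgx : g x = 1 := by simp [g, h₀]
  have hgn : ‖g‖ ≤ 1 := by
    rw [hg, norm_smul, norm_inv, Real.norm_eq_abs, ← hf, inv_mul_cancel₀ (abs_ne_zero.2 h₀)]
  have hE : lux (seq x) ^ 4 + quart (seq x) = 1 := by
    have := norm_pow_eq x
    rw [hx, one_pow] at this
    exact this.symm
  have hle (w : NullSpace) (hw : L (seq w) ≤ 0) : g w ≤ quartSlope (seq x) (seq w) := by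
    have hlim : Tendsto (fun ε : ℝ => quartSlope (seq x) (seq w) + ε * (1 - quart (seq x)))
        (𝓝[>] 0) (𝓝 (quartSlope (seq x) (seq w))) :=
      tendsto_nhdsWithin_of_tendsto_nhds <| by
        have : Continuous fun ε : ℝ => quartSlope (seq x) (seq w) + ε * (1 - quart (seq x)) := by
          fun_prop
        simpa using this.tendsto 0
    refine ge_of_tendsto hlim ?_
    filter_upwards [self_mem_nhdsWithin] with ε (hε : 0 < ε)
    have h := apply_le_quartSlope hx (hL (seq (w + -ε • x)) (tendsto_seq _) (by
      rw [map_add, map_smul, map_add, map_smul, hLx, smul_eq_mul]; linarith)) hgn hgx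
    rw [map_add, map_smul, map_add, map_smul, quartSlope_add, quartSlope_smul, quartSlope_self,
      hgx, smul_eq_mul] at h
    linarith
  have hgz : g z = quartSlope (seq x) (seq z) + lux (seq x) ^ 4 * L (seq z) := by
    have hkey (c : ℝ) : c * (g z - L (seq z)) ≤
        c * (quartSlope (seq x) (seq z) - L (seq z) * quart (seq x)) := by
      have h := hle (c • (z + -L (seq z) • x)) (by
        simp only [map_add, map_smul, hLx, smul_eq_mul]
        exact le_of_eq (by ring))
      simp only [map_add, map_smul, quartSlope_add, quartSlope_smul, quartSlope_self,
        hgx, smul_eq_mul] at h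
      linarith
    have h₁ := hkey 1
    have h₂ := hkey (-1)
    rw [show lux (seq x) ^ 4 = 1 - quart (seq x) by linarith]
    linarith
  rw [← hgz, hg, smul_apply, smul_eq_mul, mul_inv_cancel_left₀ h₀]

/-- At every unit vector the norm-attaining functionals have a common direction, which on all but
finitely many unit vectors is given by `quartSlope`. -/
lemma exists_direction {x : NullSpace} (hx : ‖x‖ = 1) :
    ∃ D : NullSpace → ℝ, (∀ f : NullSpace →L[ℝ] ℝ, |f x| = ‖f‖ → ∀ z, f z = f x * D z) ∧
      ∃ K, ∀ k ≥ K, D (unit k) = quartSlope (seq x) (unitSeq k) := by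
  have hx₀ : seq x ≠ 0 := fun h => by
    rw [seq_injective (h.trans (map_zero seq).symm), norm_zero] at hx
    exact zero_ne_one hx
  obtain ⟨L, hLx, ⟨K, hK⟩, hL⟩ := exists_lux_slope (tendsto_seq x) hx₀
  refine ⟨fun z => quartSlope (seq x) (seq z) + lux (seq x) ^ 4 * L (seq z),
    fun f hf z => apply_eq_of_abs_apply_eq_norm hx hLx hL hf z, K, fun k hk => ?_⟩
  simp only [seq_unit, hK k hk, mul_zero, add_zero]

lemma eq_or_eq_neg_of_cross_eq {x y : NullSpace} (hx : ‖x‖ = 1) (hy : ‖y‖ = 1)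
    (h : ∀ i j, seq x i * seq y j = seq x j * seq y i) : x = y ∨ x = -y := by
  have hy₀ : ∃ j, seq y j ≠ 0 := by
    by_contra! hcon
    have : y = 0 := seq_injective <| by
      rw [map_zero]
      ext j
      exact hcon j
    rw [this, norm_zero] at hy
    exact zero_ne_one hy
  obtain ⟨j, hj⟩ := hy₀
  have hxy : x = (seq x j / seq y j) • y := seq_injective <| by
    ext i
    have hi : seq x i = seq x j / seq y j * seq y i := by
      rw [div_mul_eq_mul_div, eq_div_iff hj]
      exact h i j
    rw [map_smul]
    exact hi
  have hc : |seq x j / seq y j| = 1 := by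
    have := congrArg norm hxy
    rwa [norm_smul, hx, hy, mul_one, eq_comm, Real.norm_eq_abs] at this
  rcases eq_or_eq_neg_of_abs_eq hc with hc | hc
  · exact .inl (by rw [hxy, hc, one_smul])
  · exact .inr (by rw [hxy, hc, neg_one_smul])

lemma not_linearIndependent_of_attaining {f g : NullSpace →L[ℝ] ℝ} {x y z : NullSpace} {t : ℝ}
    (hx : ‖x‖ = 1) (hfx : |f x| = ‖f‖) (hy : ‖y‖ = 1) (hgy : |g y| = ‖g‖) (hz : ‖z‖ = 1)
    (ht₀ : t ≠ 0) (ht₁ : 1 - t ≠ 0)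
    (hfgz : |(t • f + (1 - t) • g) z| = ‖t • f + (1 - t) • g‖) :
    ¬ LinearIndependent ℝ ![f, g] := by
  intro hli
  have hf₀ : f x ≠ 0 := fun h => hli.ne_zero 0 <| by
    rw [h, abs_zero] at hfx
    exact norm_eq_zero.1 hfx.symm
  have hg₀ : g y ≠ 0 := fun h => hli.ne_zero 1 <| by
    rw [h, abs_zero] at hgy
    exact norm_eq_zero.1 hgy.symm
  obtain ⟨D, hD, K₁, hK₁⟩ := exists_direction hx
  obtain ⟨D', hD', K₂, hK₂⟩ := exists_direction hy
  obtain ⟨D'', hD'', K₃, hK₃⟩ := exists_direction hz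
  set γ := (t • f + (1 - t) • g) z
  have hcross := cross_eq_of_probe_cubic (x := seq x) (y := seq y) (z := seq z)
    (mul_ne_zero ht₀ hf₀) (mul_ne_zero ht₁ hg₀) (γ := γ)
    (eq_zero_of_finite_support
      (C := |t * f x| * (4 * ‖seq x‖) ^ 3 + |(1 - t) * g y| * (4 * ‖seq y‖) ^ 3 +
        |γ| * (4 * ‖seq z‖) ^ 3)
      (K := max K₁ (max K₂ K₃)) (fun n => ?_) fun k hk => ?_)
  · have hpar : ∀ w : NullSpace, f w * g x = f x * g w := fun w => by
      have hgx : |g x| = ‖g‖ := by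
        rcases eq_or_eq_neg_of_cross_eq hx hy hcross with rfl | rfl
        · exact hgy
        · rw [map_neg, abs_neg, hgy]
      rw [hD f hfx w, hD g hgx w]
      ring
    have := LinearIndependent.pair_iff.1 hli (g x) (-f x) (by
      ext w
      simp only [add_apply, smul_apply, smul_eq_mul, zero_apply]
      linarith [hpar w])
    exact hf₀ (neg_eq_zero.1 this.2)
  · refine (abs_sub _ _).trans (add_le_add ((abs_add_le _ _).trans (add_le_add ?_ ?_)) ?_) <;>
    · rw [abs_mul]
      exact mul_le_mul_of_nonneg_left (abs_probe_pow_le n 3 _) (abs_nonneg _)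
  · have h := hD'' _ hfgz (unit k)
    rw [add_apply, smul_apply, smul_apply, smul_eq_mul, smul_eq_mul, hD f hfx, hD' g hgy,
      hK₁ k (by omega), hK₂ k (by omega), hK₃ k (by omega)] at h
    have hs := ((((summable_quartSlope (seq x) (unitSeq k)).hasSum.mul_left (t * f x)).add
      ((summable_quartSlope (seq y) (unitSeq k)).hasSum.mul_left ((1 - t) * g y))).sub
      ((summable_quartSlope (seq z) (unitSeq k)).hasSum.mul_left γ)).tsum_eq
    refine (tsum_congr fun n => ?_).trans (hs.trans ?_)
    · ring
    · simp only [quartSlope] at h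
      linarith

instance : StrictConvexSpace ℝ NullSpace := by
  refine StrictConvexSpace.of_norm_add_ne_two fun x y hx hy hxy => ne_of_lt ?_
  rw [norm_eq_mixed, map_add]
  exact mixed_add_lt_two hx.le hy.le (seqₗ_injective.ne hxy)

end NullSpace

lemma norm_add_lt_of_linearIndependent {E : Type*} [NormedAddCommGroup E] [NormedSpace ℝ E]
    [StrictConvexSpace ℝ E] {u v : E} (h : LinearIndependent ℝ ![u, v]) :
    ‖u + v‖ < ‖u‖ + ‖v‖ :=
  norm_add_lt_of_not_sameRay fun hs =>
    sameRay_or_sameRay_neg_iff_not_linearIndependent.1 (.inl hs) h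

end ExtremelyNonlineable

/-- There exists an infinite-dimensional real Banach space `X` such that (i) whenever
`f, g ∈ NA(X, ℝ)` are linearly independent and `0 < t < 1`, the functional
`t • f + (1 - t) • g` is not norm-attaining, and (ii) the bidual `X**` is strictly convex
(for any two linearly independent vectors `u, v` one has `‖u + v‖ < ‖u‖ + ‖v‖`);
in particular `X` itself is strictly convex. -/
theorem statement5 :
    ∃ (X : Type) (_ : NormedAddCommGroup X) (_ : NormedSpace ℝ X) (_ : CompleteSpace X),
      ¬ FiniteDimensional ℝ X ∧
      (∀ f g : X →L[ℝ] ℝ,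
        (∃ x : X, ‖x‖ = 1 ∧ |f x| = ‖f‖) →
        (∃ x : X, ‖x‖ = 1 ∧ |g x| = ‖g‖) →
        LinearIndependent ℝ ![f, g] →
        ∀ t : ℝ, 0 < t → t < 1 →
          ¬ ∃ x : X, ‖x‖ = 1 ∧ |(t • f + (1 - t) • g) x| = ‖t • f + (1 - t) • g‖) ∧
      (∀ F G : (X →L[ℝ] ℝ) →L[ℝ] ℝ, LinearIndependent ℝ ![F, G] → ‖F + G‖ < ‖F‖ + ‖G‖) ∧
      (∀ u v : X, LinearIndependent ℝ ![u, v] → ‖u + v‖ < ‖u‖ + ‖v‖) := by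
  refine ⟨ExtremelyNonlineable.NullSpace, _, _, inferInstance,
    ExtremelyNonlineable.NullSpace.not_finiteDimensional, ?_,
    fun _ _ => ExtremelyNonlineable.norm_add_lt_of_linearIndependent
      (E := (ExtremelyNonlineable.NullSpace →L[ℝ] ℝ) →L[ℝ] ℝ),
    fun _ _ => ExtremelyNonlineable.norm_add_lt_of_linearIndependent⟩
  rintro f g ⟨x, hx, hfx⟩ ⟨y, hy, hgy⟩ hli t ht₀ ht₁ ⟨z, hz, hfgz⟩
  exact ExtremelyNonlineable.NullSpace.not_linearIndependent_of_attaining hx hfx hy hgy hz ht₀.ne'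
    (sub_pos.2 ht₁).ne' hfgz hli
end
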